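/- Assume: (1) at least one minimizer of (P) is a KKT point of (P); (2) (I_1,…,I_s) satisfies the RIP; (3) for each i ∈ [s], IQ_{I_i}(h^{(i)},g^{(i)}) is archimedean; and Assumption 3.1 holds. Then lim_{d→∞} ϑ_d = f_min, i.e., the optimal values of the correlative sparse SOS relaxations of the CS-LME reformulation converge to the optimal value of (P) as the relaxation order d tends to infinity. -/

import Mathlib

open MvPolynomial Finset
open scoped Classical

noncomputable section

/-- Union of the earlier blocks `J 0, …, J (i-1)`. -/
def prevUnion {s : ℕ} {α : Type*} (J : Fin s → Finset α) (i : Fin s) : Finset α :=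
  (Finset.univ.filter (fun j => j < i)).biUnion J

/-- The arc relation produced by Algorithm 1: `(i, t)` is an arc iff `t < i`,
the intersection of `I i` with the union of the earlier blocks is nonempty and
contained in `I t`, and `t` is the largest such index. -/
def Arc {n s : ℕ} (I : Fin s → Finset (Fin n)) (i t : Fin s) : Prop :=
  t < i ∧ (I i ∩ prevUnion I i).Nonempty ∧ I i ∩ prevUnion I i ⊆ I t ∧
    ∀ t' : Fin s, t < t' → t' < i → ¬ I i ∩ prevUnion I i ⊆ I t'

/-- The running intersection property. -/
def RIP {n s : ℕ} (I : Fin s → Finset (Fin n)) : Prop :=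
  ∀ i : Fin s, 0 < (i : ℕ) → ∃ t : Fin s, t < i ∧ I i ∩ prevUnion I i ⊆ I t

/-- The index set `𝒥_i = {(i,t,k) : t ∈ 𝒜_i, k ∈ C_{i,t}} ∪ {(t,i,k) : t ∈ 𝒟_i, k ∈ C_{t,i}}`
of the additional variables attached to block `i`. -/
def Jset {n s : ℕ} (I : Fin s → Finset (Fin n)) (i : Fin s) :
    Finset (Fin s × Fin s × Fin n) :=
  Finset.univ.filter (fun q => (q.1 = i ∨ q.2.1 = i) ∧ Arc I q.1 q.2.1 ∧
    q.2.2 ∈ I q.1 ∩ I q.2.1)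

/-- The enlarged block `hat I_i`: the disjoint union of `I i` and `𝒥_i`
(two disjoint sorts, realized as a sum type). -/
def hatI {n s : ℕ} (I : Fin s → Finset (Fin n)) (i : Fin s) :
    Finset (Fin n ⊕ (Fin s × Fin s × Fin n)) :=
  (I i).map ⟨Sum.inl, Sum.inl_injective⟩ ∪ (Jset I i).map ⟨Sum.inr, Sum.inr_injective⟩

/-- The variables of the CS-LME reformulation: the original variables `x`
(sort `Fin n`) together with the additional variables `ν_{i,t,k}`. -/
abbrev BigVar (n s : ℕ) : Type := Fin n ⊕ (Fin s × Fin s × Fin n)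

/-- The polynomial vector `F_i(x^{(i)}, ν^{(i)})`, componentwise:
`F_i = ∇_i f_i − Σ_{t ∈ 𝒜_i} ν^{(i,t)} + Σ_{t ∈ 𝒟_i} ν^{(t,i)}`. -/
def FpolyP {n s : ℕ} (I : Fin s → Finset (Fin n)) (f : Fin s → MvPolynomial (Fin n) ℝ)
    (i : Fin s) (k : Fin n) : MvPolynomial (BigVar n s) ℝ :=
  rename Sum.inl (pderiv k (f i))
    - (∑ t, if Arc I i t ∧ k ∈ I i ∩ I t then X (Sum.inr (i, t, k)) else 0)
    + (∑ t, if Arc I t i ∧ k ∈ I t ∩ I i then X (Sum.inr (t, i, k)) else 0)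

/-- The CS-LME `p^{(i)} = L_i(x^{(i)}) F_i(x^{(i)}, ν^{(i)})`, as a polynomial
in the variables `(x^{(i)}, ν^{(i)})`. -/
def pPoly {n s : ℕ} (I : Fin s → Finset (Fin n)) (f : Fin s → MvPolynomial (Fin n) ℝ)
    {mh : Fin s → ℕ} (L : ∀ i, Fin (mh i) → Fin n → MvPolynomial (Fin n) ℝ)
    (i : Fin s) (j : Fin (mh i)) : MvPolynomial (BigVar n s) ℝ :=
  ∑ k ∈ I i, rename Sum.inl (L i j k) * FpolyP I f i k

/-- The tuple `φ^{(i)}` of equality constraints of the CS-LME reformulation: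
the gradient residual `F_i − Σ_j p^{(i)}_j ∇_i c^{(i)}_j` (componentwise on `Fin n`;
it vanishes identically outside `I i`), the equalities `h^{(i)}`, and the
complementarity products `p^{(i)}_j g^{(i)}_j`. -/
def phiP {n s : ℕ} (I : Fin s → Finset (Fin n)) (f : Fin s → MvPolynomial (Fin n) ℝ)
    {m ℓ : Fin s → ℕ} (c : ∀ i, Fin (m i + ℓ i) → MvPolynomial (Fin n) ℝ)
    (L : ∀ i, Fin (m i + ℓ i) → Fin n → MvPolynomial (Fin n) ℝ) (i : Fin s) :
    (Fin n ⊕ (Fin (ℓ i) ⊕ Fin (m i))) → MvPolynomial (BigVar n s) ℝ :=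
  Sum.elim
    (fun k => FpolyP I f i k
      - ∑ j, pPoly I f L i j * rename Sum.inl (pderiv k (c i j)))
    (Sum.elim
      (fun j => rename Sum.inl (c i (Fin.natAdd (m i) j)))
      (fun j => pPoly I f L i (Fin.castAdd (ℓ i) j)
        * rename Sum.inl (c i (Fin.castAdd (ℓ i) j))))

/-- The tuple `ψ^{(i)}` of inequality constraints of the CS-LME reformulation:
the multipliers `p^{(i)}_j` (for `j ∈ [m_i]`) and the inequalities `g^{(i)}`. -/
def psiP {n s : ℕ} (I : Fin s → Finset (Fin n)) (f : Fin s → MvPolynomial (Fin n) ℝ)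
    {m ℓ : Fin s → ℕ} (c : ∀ i, Fin (m i + ℓ i) → MvPolynomial (Fin n) ℝ)
    (L : ∀ i, Fin (m i + ℓ i) → Fin n → MvPolynomial (Fin n) ℝ) (i : Fin s) :
    (Fin (m i) ⊕ Fin (m i)) → MvPolynomial (BigVar n s) ℝ :=
  Sum.elim
    (fun j => pPoly I f L i (Fin.castAdd (ℓ i) j))
    (fun j => rename Sum.inl (c i (Fin.castAdd (ℓ i) j)))

/-- `Σ[z]_e`: sums of squares of polynomials in the variables `J`, of degree at most `e`. -/
def SOSdeg {V : Type*} (J : Finset V) (e : ℕ) : Set (MvPolynomial V ℝ) :=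
  {p | ∃ (t : ℕ) (q : Fin t → MvPolynomial V ℝ),
      (∀ a, (q a).vars ⊆ J ∧ 2 * (q a).totalDegree ≤ e) ∧ p = ∑ a, q a ^ 2}

/-- The truncation `IQ(hs, gs)_e = Ideal(hs)_e + Qmod(gs)_e` in the variables `J`. -/
def IQdeg {V ι κ : Type*} [Fintype ι] [Fintype κ] (J : Finset V)
    (hs : ι → MvPolynomial V ℝ) (gs : κ → MvPolynomial V ℝ) (e : ℕ) :
    Set (MvPolynomial V ℝ) :=
  {p | ∃ (q : ι → MvPolynomial V ℝ) (σ0 : MvPolynomial V ℝ)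
      (σ : κ → MvPolynomial V ℝ),
      (∀ j, (q j).vars ⊆ J ∧ (q j).totalDegree ≤ e - (hs j).totalDegree) ∧
      σ0 ∈ SOSdeg J e ∧
      (∀ j, σ j ∈ SOSdeg J (e - (gs j).totalDegree)) ∧
      p = (∑ j, hs j * q j) + σ0 + ∑ j, gs j * σ j}

/-- Sums of squares of polynomials in the variables `J` (no degree bound). -/
def SOSFull {V : Type*} (J : Finset V) : Set (MvPolynomial V ℝ) :=
  {p | ∃ (t : ℕ) (q : Fin t → MvPolynomial V ℝ),
      (∀ a, (q a).vars ⊆ J) ∧ p = ∑ a, q a ^ 2}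

/-- `IQ(hs, gs) = Ideal(hs) + Qmod(gs)` in the variables `J` (no degree bound). -/
def IQFull {V ι κ : Type*} [Fintype ι] [Fintype κ] (J : Finset V)
    (hs : ι → MvPolynomial V ℝ) (gs : κ → MvPolynomial V ℝ) :
    Set (MvPolynomial V ℝ) :=
  {p | ∃ (q : ι → MvPolynomial V ℝ) (σ0 : MvPolynomial V ℝ)
      (σ : κ → MvPolynomial V ℝ),
      (∀ j, (q j).vars ⊆ J) ∧ σ0 ∈ SOSFull J ∧ (∀ j, σ j ∈ SOSFull J) ∧
      p = (∑ j, hs j * q j) + σ0 + ∑ j, gs j * σ j}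

universe u

/-! ### Orderings -/

/-- A proper preordering of a commutative ring. -/
structure IsPreordering {A : Type*} [CommRing A] (T : Set A) : Prop where
  add : ∀ {a b}, a ∈ T → b ∈ T → a + b ∈ T
  mul : ∀ {a b}, a ∈ T → b ∈ T → a * b ∈ T
  sq : ∀ a, a ^ 2 ∈ T
  neg_one : (-1 : A) ∉ T

namespace IsPreordering

variable {A : Type*} [CommRing A] {T : Set A}

lemma zero (h : IsPreordering T) : (0 : A) ∈ T := by simpa using h.sq 0

lemma one (h : IsPreordering T) : (1 : A) ∈ T := by simpa using h.sq 1

lemma adjoin (h : IsPreordering T) {a : A} (ha : ∀ x ∈ T, ∀ y ∈ T, -1 ≠ x + a * y) :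
    IsPreordering {z | ∃ x ∈ T, ∃ y ∈ T, z = x + a * y} where
  add := by
    rintro _ _ ⟨x, hx, y, hy, rfl⟩ ⟨x', hx', y', hy', rfl⟩
    exact ⟨x + x', h.add hx hx', y + y', h.add hy hy', by ring⟩
  mul := by
    rintro _ _ ⟨x, hx, y, hy, rfl⟩ ⟨x', hx', y', hy', rfl⟩
    exact ⟨x * x' + a ^ 2 * (y * y'), h.add (h.mul hx hx') (h.mul (h.sq a) (h.mul hy hy')),
      x * y' + y * x', h.add (h.mul hx hy') (h.mul hy hx'), by ring⟩
  sq := fun z => ⟨z ^ 2, h.sq z, 0, h.zero, by ring⟩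
  neg_one := by
    rintro ⟨x, hx, y, hy, e⟩
    exact ha x hx y hy e

/-- Every proper preordering extends to an ordering with prime support. -/
lemma exists_ordering (h : IsPreordering T) :
    ∃ P : Set A, IsPreordering P ∧ T ⊆ P ∧ (∀ a, a ∈ P ∨ -a ∈ P) ∧
      ∀ a b, a * b ∈ P → -(a * b) ∈ P → (a ∈ P ∧ -a ∈ P) ∨ (b ∈ P ∧ -b ∈ P) := by
  obtain ⟨P, hTP, hP⟩ := zorn_subset_nonempty {T : Set A | IsPreordering T} (by
    intro c hc hch hne
    refine ⟨⋃₀ c, ?_, fun s hs => Set.subset_sUnion_of_mem hs⟩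
    have two : ∀ {a b}, a ∈ ⋃₀ c → b ∈ ⋃₀ c → ∃ S ∈ c, a ∈ S ∧ b ∈ S := by
      rintro a b ⟨S, hS, ha⟩ ⟨S', hS', hb⟩
      rcases hch.total hS hS' with h | h
      · exact ⟨S', hS', h ha, hb⟩
      · exact ⟨S, hS, ha, h hb⟩
    refine ⟨fun ha hb => ?_, fun ha hb => ?_, fun a => ?_, ?_⟩
    · obtain ⟨S, hS, h1, h2⟩ := two ha hb
      exact ⟨S, hS, (hc hS).add h1 h2⟩
    · obtain ⟨S, hS, h1, h2⟩ := two ha hb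
      exact ⟨S, hS, (hc hS).mul h1 h2⟩
    · obtain ⟨S, hS⟩ := hne
      exact ⟨S, hS, (hc hS).sq a⟩
    · rintro ⟨S, hS, h1⟩
      exact (hc hS).neg_one h1) T h
  have hPO : IsPreordering P := hP.prop
  have key : ∀ a, a ∉ P → ∃ x ∈ P, ∃ y ∈ P, -1 = x + a * y := by
    intro a ha
    by_contra! hcon
    have h1 := hPO.adjoin hcon
    refine ha (hP.le_of_ge h1 (fun x hx => ⟨x, hx, 0, hPO.zero, by ring⟩)
      ⟨0, hPO.zero, 1, hPO.one, by ring⟩)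
  refine ⟨P, hPO, hTP, ?_, ?_⟩
  · intro a
    by_contra! hcon
    obtain ⟨x, hx, y, hy, e⟩ := key a hcon.1
    obtain ⟨x', hx', y', hy', e'⟩ := key (-a) hcon.2
    refine hPO.neg_one ?_
    have : (-1 : A) = x + x' + x * x' + a ^ 2 * (y * y') := by
      linear_combination (1 + x') * e - a * y * e'
    rw [this]
    exact hPO.add (hPO.add (hPO.add hx hx') (hPO.mul hx hx'))
      (hPO.mul (hPO.sq a) (hPO.mul hy hy'))
  · have aux : ∀ u v, u ∉ P → v ∉ P → -(u * v) ∈ P → False := by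
      intro u v hu hv huv
      obtain ⟨x, hx, y, hy, e⟩ := key u hu
      obtain ⟨x', hx', y', hy', e'⟩ := key v hv
      refine hPO.neg_one ?_
      have : (-1 : A) = x + x' + x * x' + -(u * v) * (y * y') := by
        linear_combination (1 + x') * e - u * y * e'
      rw [this]
      exact hPO.add (hPO.add (hPO.add hx hx') (hPO.mul hx hx'))
        (hPO.mul huv (hPO.mul hy hy'))
    intro a b h1 h2
    by_contra! hcon
    obtain ⟨ha, hb⟩ := hcon
    by_cases ha' : a ∈ P <;> by_cases hb' : b ∈ P
    · exact aux _ _ (ha ha') (hb hb') (by simpa using h2)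
    · exact aux _ _ (ha ha') hb' (by simpa using h1)
    · exact aux _ _ ha' (hb hb') (by simpa using h1)
    · exact aux _ _ ha' hb' h2

/-- A proper preordering of a field is contained in the nonnegative cone of a linear order. -/
lemma exists_linearOrder {K : Type*} [Field K] {T : Set K} (h : IsPreordering T) :
    ∃ _ : LinearOrder K, IsStrictOrderedRing K ∧ ∀ x ∈ T, 0 ≤ x := by
  obtain ⟨P, hP, hTP, htot, -⟩ := h.exists_ordering
  let C : RingCone K :=
    { carrier := P
      add_mem' := hP.add
      mul_mem' := hP.mul
      zero_mem' := hP.zero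
      one_mem' := hP.one
      eq_zero_of_mem_of_neg_mem' := by
        intro a h1 h2
        by_contra h0
        refine hP.neg_one ?_
        have : (-1 : K) = a * (-a) * a⁻¹ ^ 2 := by field_simp
        rw [this]
        exact hP.mul (hP.mul h1 h2) (hP.sq _) }
  have : HasMemOrNegMem C := ⟨htot⟩
  let o : LinearOrder K := LinearOrder.mkOfAddGroupCone C
  have : IsOrderedRing K := IsOrderedRing.mkOfCone C
  refine ⟨o, inferInstance, fun x hx => ?_⟩
  change x - 0 ∈ P
  simpa using hTP hx

end IsPreordering

/-! ### Ordered fields with the intermediate value property -/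

/-- The intermediate value property for polynomials over an ordered field. -/
def HasIVT (K : Type*) [Field K] [LinearOrder K] : Prop :=
  ∀ (g : Polynomial K) (a b : K), a < b → g.eval a * g.eval b < 0 →
    ∃ c, a < c ∧ c < b ∧ g.eval c = 0

lemma hasIVT_of_irreducible {K : Type*} [Field K] [LinearOrder K] [IsStrictOrderedRing K]
    (H : ∀ g : Polynomial K, Irreducible g → 1 < g.natDegree → ∃ R h : Polynomial K,
      (∀ x, 0 ≤ R.eval x) ∧ 1 + R = g * h ∧ h.natDegree < g.natDegree) : HasIVT K := by
  intro g
  induction hd : g.natDegree using Nat.strong_induction_on generalizing g with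
  | _ d ih =>
  subst hd
  intro a b hab hlt
  have hg0 : g ≠ 0 := by
    rintro rfl
    simp at hlt
  have hdeg : 0 < g.natDegree := by
    by_contra h
    have : g.natDegree = 0 := by omega
    obtain ⟨u, rfl⟩ := Polynomial.natDegree_eq_zero.1 this
    simp only [Polynomial.eval_C] at hlt
    nlinarith [mul_self_nonneg u]
  by_cases hirr : Irreducible g
  · rcases Nat.lt_or_ge 1 g.natDegree with h1 | h1
    · obtain ⟨R, h, hR, hRg, hlt'⟩ := H g hirr h1
      have hev : ∀ x, 0 < g.eval x * h.eval x := by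
        intro x
        have := congrArg (Polynomial.eval x) hRg
        simp only [Polynomial.eval_add, Polynomial.eval_one, Polynomial.eval_mul] at this
        rw [← this]
        have := hR x
        linarith
      have hh : h.eval a * h.eval b < 0 := by
        by_contra hcon
        push Not at hcon
        have h2 := mul_pos (hev a) (hev b)
        nlinarith [mul_nonneg (neg_nonneg.2 hlt.le) hcon]
      obtain ⟨r, -, -, hr⟩ := ih _ hlt' h rfl a b hab hh
      have := hev r
      simp [hr] at this
    · have hd1 : g.natDegree = 1 := by omega
      obtain ⟨u, hu, v, rfl⟩ := Polynomial.natDegree_eq_one.1 hd1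
      have e : ∀ x, u * x + v = u * (x - (-v / u)) := by
        intro x; field_simp; ring
      simp only [Polynomial.eval_add, Polynomial.eval_mul, Polynomial.eval_C,
        Polynomial.eval_X, e] at hlt ⊢
      set w := -v / u
      have h3 : (a - w) * (b - w) < 0 := by
        by_contra hcon
        push Not at hcon
        nlinarith [mul_nonneg (mul_self_nonneg u) hcon]
      refine ⟨w, ?_, ?_, by simp⟩
      · by_contra hcon
        push Not at hcon
        nlinarith
      · by_contra hcon
        push Not at hcon
        nlinarith
  · have hnu : ¬ IsUnit g := fun hu => by
      have := Polynomial.natDegree_eq_zero_of_isUnit hu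
      omega
    rw [irreducible_iff] at hirr
    push Not at hirr
    obtain ⟨p, q, rfl, hp, hq⟩ := hirr hnu
    have hp0 : p ≠ 0 := left_ne_zero_of_mul hg0
    have hq0 : q ≠ 0 := right_ne_zero_of_mul hg0
    have hpd : 0 < p.natDegree := Polynomial.natDegree_pos_iff_degree_pos.2
      (Polynomial.degree_pos_of_ne_zero_of_nonunit hp0 hp)
    have hqd : 0 < q.natDegree := Polynomial.natDegree_pos_iff_degree_pos.2
      (Polynomial.degree_pos_of_ne_zero_of_nonunit hq0 hq)
    have hm := Polynomial.natDegree_mul hp0 hq0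
    simp only [Polynomial.eval_mul] at hlt
    rcases lt_or_ge (p.eval a * p.eval b) 0 with h1 | h1
    · obtain ⟨c, h2, h3, h4⟩ := ih p.natDegree (by omega) p rfl a b hab h1
      exact ⟨c, h2, h3, by simp [h4]⟩
    · have h2 : q.eval a * q.eval b < 0 := by
        by_contra hcon
        push Not at hcon
        nlinarith [mul_nonneg h1 hcon]
      obtain ⟨c, h2, h3, h4⟩ := ih q.natDegree (by omega) q rfl a b hab h2
      exact ⟨c, h2, h3, by simp [h4]⟩

/-- Weighted sums of squares, with weights from a set `P` of base field elements. -/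
def weightedSOS {F : Type*} (Ω : Type*) [Field F] [Field Ω] [Algebra F Ω] (P : Set F)
    (S : Set Ω) : AddSubmonoid Ω :=
  AddSubmonoid.closure {z | ∃ c ∈ P, ∃ e ∈ S, z = algebraMap F Ω c * e ^ 2}

lemma weightedSOS_mul {F Ω : Type*} [Field F] [Field Ω] [Algebra F Ω] {P : Set F}
    (hP : ∀ {a b}, a ∈ P → b ∈ P → a * b ∈ P) (E : IntermediateField F Ω) {x y : Ω}
    (hx : x ∈ weightedSOS Ω P (E : Set Ω)) (hy : y ∈ weightedSOS Ω P (E : Set Ω)) :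
    x * y ∈ weightedSOS Ω P (E : Set Ω) := by
  have := AddSubmonoid.mul_mem_mul hx hy
  rw [weightedSOS, AddSubmonoid.closure_mul_closure] at this
  refine AddSubmonoid.closure_mono ?_ this
  rintro _ ⟨_, ⟨c, hc, e, he, rfl⟩, _, ⟨c', hc', e', he', rfl⟩, rfl⟩
  exact ⟨c * c', hP hc hc', e * e', E.mul_mem he he', by simp only [map_mul]; ring⟩

/-- A field with a preordering maps to an ordered field with the intermediate value property. -/
lemma IsPreordering.exists_hasIVT_of_field {F : Type u} [Field F] {P : Set F}
    (hP : IsPreordering P) :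
    ∃ (K : Type u) (_ : Field K) (_ : LinearOrder K) (φ : F →+* K),
      IsStrictOrderedRing K ∧ HasIVT K ∧ ∀ x ∈ P, 0 ≤ φ x := by
  let Ω := AlgebraicClosure F
  let good : Set (IntermediateField F Ω) := {E | (-1 : Ω) ∉ weightedSOS Ω P (E : Set Ω)}
  have hbot : (⊥ : IntermediateField F Ω) ∈ good := by
    intro h
    have : ∀ z ∈ weightedSOS Ω P ((⊥ : IntermediateField F Ω) : Set Ω),
        ∃ c ∈ P, z = algebraMap F Ω c := by
      intro z hz
      refine AddSubmonoid.closure_induction (motive := fun z _ => ∃ c ∈ P, z = algebraMap F Ω c)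
        ?_ ⟨0, hP.zero, by simp⟩ ?_ hz
      · rintro _ ⟨c, hc, e, he, rfl⟩
        obtain ⟨y, rfl⟩ := IntermediateField.mem_bot.1 he
        exact ⟨c * y ^ 2, hP.mul hc (hP.sq y), by simp⟩
      · rintro _ _ _ _ ⟨c, hc, rfl⟩ ⟨c', hc', rfl⟩
        exact ⟨c + c', hP.add hc hc', by simp⟩
    obtain ⟨c, hc, e⟩ := this _ h
    have : c = -1 := (algebraMap F Ω).injective (by rw [← e]; simp)
    exact hP.neg_one (this ▸ hc)
  obtain ⟨E, -, hE⟩ := zorn_le_nonempty₀ good (by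
    intro c hc hch y hy
    have hdir : Directed (· ≤ ·) (fun E : c => (E : IntermediateField F Ω)) :=
      hch.directedOn.directed_val
    have : Nonempty c := ⟨⟨y, hy⟩⟩
    refine ⟨⨆ E : c, (E : IntermediateField F Ω), ?_, fun z hz =>
      le_iSup (fun E : c => (E : IntermediateField F Ω)) ⟨z, hz⟩⟩
    intro h
    have : ∀ z ∈ weightedSOS Ω P ((⨆ E : c, (E : IntermediateField F Ω) :
        IntermediateField F Ω) : Set Ω), ∃ E ∈ c, z ∈ weightedSOS Ω P (E : Set Ω) := by
      intro z hz
      refine AddSubmonoid.closure_induction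
        (motive := fun z _ => ∃ E ∈ c, z ∈ weightedSOS Ω P (E : Set Ω)) ?_ ?_ ?_ hz
      · rintro _ ⟨d, hd, e, he, rfl⟩
        rw [IntermediateField.coe_iSup_of_directed hdir] at he
        obtain ⟨E, hE⟩ := Set.mem_iUnion.1 he
        exact ⟨E, E.2, AddSubmonoid.subset_closure ⟨d, hd, e, hE, rfl⟩⟩
      · exact ⟨y, hy, zero_mem _⟩
      · rintro u v _ _ ⟨E, hE, hu⟩ ⟨E', hE', hv⟩
        have mono : ∀ {E E' : IntermediateField F Ω}, E ≤ E' →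
            weightedSOS Ω P (E : Set Ω) ≤ weightedSOS Ω P (E' : Set Ω) := by
          intro E E' hle
          refine AddSubmonoid.closure_mono ?_
          rintro _ ⟨d, hd, e, he, rfl⟩
          exact ⟨d, hd, e, hle he, rfl⟩
        rcases hch.total hE hE' with h | h
        · exact ⟨E', hE', add_mem (mono h hu) hv⟩
        · exact ⟨E, hE, add_mem hu (mono h hv)⟩
    obtain ⟨E, hE, h'⟩ := this _ h
    exact hc hE h') ⊥ hbot
  have hEg : (-1 : Ω) ∉ weightedSOS Ω P (E : Set Ω) := hE.prop
  have hT : IsPreordering {x : E | (x : Ω) ∈ weightedSOS Ω P (E : Set Ω)} := by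
    refine ⟨fun ha hb => ?_, fun ha hb => ?_, fun a => ?_, ?_⟩
    · exact AddSubmonoid.add_mem (weightedSOS Ω P (E : Set Ω)) ha hb
    · exact weightedSOS_mul hP.mul E ha hb
    · exact AddSubmonoid.subset_closure ⟨1, hP.one, a, a.2, by simp⟩
    · simpa using hEg
  obtain ⟨o, ho, hpos⟩ := hT.exists_linearOrder
  have hcpos : ∀ c ∈ P, 0 ≤ algebraMap F E c := by
    intro c hc
    refine hpos _ ?_
    exact AddSubmonoid.subset_closure ⟨c, hc, 1, E.one_mem, by simp⟩
  refine ⟨E, inferInstance, o, algebraMap F E, ho, hasIVT_of_irreducible ?_, hcpos⟩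
  intro g hirr hdeg
  obtain ⟨α, hα⟩ := IsAlgClosed.exists_aeval_eq_zero Ω g
    (Polynomial.degree_pos_of_irreducible hirr).ne'
  have hαE : α ∉ E := by
    intro h
    have h0 : g.eval ⟨α, h⟩ = 0 := by
      have h1 : Polynomial.aeval (algebraMap E Ω ⟨α, h⟩) g = 0 := hα
      rw [Polynomial.aeval_algebraMap_apply] at h1
      simpa using h1
    have := Polynomial.degree_eq_one_of_irreducible_of_root hirr h0
    exact hdeg.ne' (Polynomial.natDegree_eq_of_degree_eq_some this)
  have hint : IsIntegral E α := (Algebra.IsIntegral.isIntegral (R := F) α).tower_top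
  let E' : IntermediateField F Ω := (IntermediateField.adjoin E {α}).restrictScalars F
  have hmem : ∀ z ∈ E', ∃ q : Polynomial E, z = Polynomial.aeval α q := by
    intro z hz
    have h1 : z ∈ (IntermediateField.adjoin E {α}).toSubalgebra := hz
    rw [IntermediateField.adjoin_simple_toSubalgebra_of_isAlgebraic hint.isAlgebraic,
      Algebra.adjoin_singleton_eq_range_aeval] at h1
    obtain ⟨q, hq⟩ := h1
    exact ⟨q, hq.symm⟩
  have hEE' : E ≤ E' := fun z hz => (IntermediateField.adjoin E {α}).algebraMap_mem ⟨z, hz⟩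
  have hbad : (-1 : Ω) ∈ weightedSOS Ω P (E' : Set Ω) := by
    by_contra h
    exact hαE (hE.le_of_ge (y := E') h hEE' (IntermediateField.mem_adjoin_simple_self E α))
  have hR : ∀ z ∈ weightedSOS Ω P (E' : Set Ω), ∃ R : Polynomial E,
      (∀ x, 0 ≤ R.eval x) ∧ Polynomial.aeval α R = z ∧ R.natDegree ≤ 2 * (g.natDegree - 1) := by
    intro z hz
    refine AddSubmonoid.closure_induction (motive := fun z _ => ∃ R : Polynomial E,
      (∀ x, 0 ≤ R.eval x) ∧ Polynomial.aeval α R = z ∧ R.natDegree ≤ 2 * (g.natDegree - 1))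
      ?_ ⟨0, by simp⟩ ?_ hz
    · rintro _ ⟨d, hd, e, he, rfl⟩
      obtain ⟨q, rfl⟩ := hmem e he
      refine ⟨Polynomial.C (algebraMap F E d) * (q % g) ^ 2, fun x => ?_, ?_, ?_⟩
      · simp only [Polynomial.eval_mul, Polynomial.eval_C, Polynomial.eval_pow]
        exact mul_nonneg (hcpos d hd) (sq_nonneg _)
      · have h1 : Polynomial.aeval α q = Polynomial.aeval α (q % g) := by
          conv_lhs => rw [← EuclideanDomain.mod_add_div q g]
          simp [hα]
        rw [h1]
        simp [← IsScalarTower.algebraMap_apply]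
      · have h1 := Polynomial.natDegree_mod_lt q (show g.natDegree ≠ 0 by omega)
        refine (Polynomial.natDegree_C_mul_le _ _).trans
          (Polynomial.natDegree_pow_le.trans ?_)
        omega
    · rintro _ _ _ _ ⟨R, h1, h2, h3⟩ ⟨R', h1', h2', h3'⟩
      refine ⟨R + R', fun x => ?_, ?_, (Polynomial.natDegree_add_le _ _).trans (max_le h3 h3')⟩
      · rw [Polynomial.eval_add]
        exact add_nonneg (h1 x) (h1' x)
      · simp [h2, h2']
  obtain ⟨R, h1, h2, h3⟩ := hR _ hbad
  have hdvd : g ∣ 1 + R := by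
    by_contra hnd
    obtain ⟨u, v, huv⟩ := (hirr.coprime_iff_not_dvd).2 hnd
    have := congrArg (Polynomial.aeval α) huv
    simp [hα, h2] at this
  obtain ⟨h, hh⟩ := hdvd
  refine ⟨R, h, h1, hh, ?_⟩
  have hne : g * h ≠ 0 := by
    intro h0
    have := congrArg (Polynomial.eval 0) (hh.trans h0)
    simp only [Polynomial.eval_add, Polynomial.eval_one, Polynomial.eval_zero] at this
    have := h1 0
    linarith
  have h4 := Polynomial.natDegree_mul (left_ne_zero_of_mul hne) (right_ne_zero_of_mul hne)
  rw [← hh] at h4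
  have h5 := Polynomial.natDegree_add_le 1 R
  rw [Polynomial.natDegree_one] at h5
  have : max 0 R.natDegree ≤ 2 * (g.natDegree - 1) := max_le (by omega) h3
  omega

/-- The preordering induced on the field of fractions of the image of an ordered ring. -/
lemma IsPreordering.fractions {A F : Type*} [CommRing A] [Field F] {P : Set A}
    (hP : IsPreordering P) (φ : A →+* F)
    (hker : ∀ a, φ a = 0 → -a ∈ P) (hfrac : ∀ z : F, ∃ a b, φ b ≠ 0 ∧ z = φ a / φ b)
    (hneg : ∀ b, -b ^ 2 ∈ P → φ b = 0) :
    IsPreordering {z : F | ∃ c ∈ P, ∃ b, φ b ≠ 0 ∧ z = φ c / φ b ^ 2} := by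
  refine ⟨?_, ?_, ?_, ?_⟩
  · rintro _ _ ⟨c, hc, b, hb, rfl⟩ ⟨c', hc', b', hb', rfl⟩
    refine ⟨c * b' ^ 2 + c' * b ^ 2, hP.add (hP.mul hc (hP.sq _)) (hP.mul hc' (hP.sq _)),
      b * b', by simp [hb, hb'], ?_⟩
    simp only [map_mul, map_add, map_pow]
    field_simp
  · rintro _ _ ⟨c, hc, b, hb, rfl⟩ ⟨c', hc', b', hb', rfl⟩
    refine ⟨c * c', hP.mul hc hc', b * b', by simp [hb, hb'], ?_⟩
    simp only [map_mul]
    field_simp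
  · intro z
    obtain ⟨a, b, hb, rfl⟩ := hfrac z
    exact ⟨a ^ 2, hP.sq a, b, hb, by simp [div_pow]⟩
  · rintro ⟨c, hc, b, hb, e⟩
    have h0 : φ (c + b ^ 2) = 0 := by
      field_simp at e
      simp only [map_add, map_pow]
      linear_combination -e
    refine hb (hneg b ?_)
    have := hP.add (hker _ h0) hc
    rwa [show -(c + b ^ 2) + c = -b ^ 2 by ring] at this

/-- A commutative ring with a proper preordering maps to an ordered field with the
intermediate value property. -/
lemma IsPreordering.exists_hasIVT {A : Type u} [CommRing A] {T : Set A} (h : IsPreordering T) :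
    ∃ (K : Type u) (_ : Field K) (_ : LinearOrder K) (φ : A →+* K),
      IsStrictOrderedRing K ∧ HasIVT K ∧ ∀ x ∈ T, 0 ≤ φ x := by
  obtain ⟨P, hP, hTP, htot, hprime⟩ := h.exists_ordering
  let 𝔭 : Ideal A :=
    { carrier := {a | a ∈ P ∧ -a ∈ P}
      add_mem' := by
        rintro a b ⟨h1, h2⟩ ⟨h3, h4⟩
        exact ⟨hP.add h1 h3, by rw [neg_add]; exact hP.add h2 h4⟩
      zero_mem' := ⟨hP.zero, by simpa using hP.zero⟩
      smul_mem' := by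
        rintro c a ⟨h1, h2⟩
        change c * a ∈ P ∧ -(c * a) ∈ P
        rcases htot c with hc | hc
        · exact ⟨hP.mul hc h1, by simpa using hP.mul hc h2⟩
        · exact ⟨by simpa using hP.mul hc h2, by simpa using hP.mul hc h1⟩ }
  have h𝔭 : 𝔭.IsPrime := by
    refine ⟨fun h => ?_, fun {a b} hab => hprime a b hab.1 hab.2⟩
    have : (1 : A) ∈ 𝔭 := h ▸ Submodule.mem_top
    exact hP.neg_one this.2
  let F := FractionRing (A ⧸ 𝔭)
  let φ : A →+* F := (algebraMap (A ⧸ 𝔭) F).comp (Ideal.Quotient.mk 𝔭)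
  have hker : ∀ a, φ a = 0 ↔ a ∈ 𝔭 := by
    intro a
    simp only [φ, RingHom.comp_apply]
    rw [IsFractionRing.to_map_eq_zero_iff, Ideal.Quotient.eq_zero_iff_mem]
  have hfrac : ∀ z : F, ∃ a b, φ b ≠ 0 ∧ z = φ a / φ b := by
    intro z
    obtain ⟨x, y, hy, rfl⟩ := IsFractionRing.div_surjective (A := A ⧸ 𝔭) z
    obtain ⟨a, rfl⟩ := Ideal.Quotient.mk_surjective x
    obtain ⟨b, rfl⟩ := Ideal.Quotient.mk_surjective y
    refine ⟨a, b, ?_, rfl⟩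
    simp only [φ, RingHom.comp_apply, ne_eq]
    rw [IsFractionRing.to_map_eq_zero_iff]
    exact nonZeroDivisors.ne_zero hy
  have hT := hP.fractions φ (fun a ha => ((hker a).1 ha).2) hfrac
    (fun b hb => (hker b).2 (h𝔭.mem_of_pow_mem 2 ⟨hP.sq b, hb⟩))
  obtain ⟨K, i1, i2, ψ, h1, h2, h3⟩ := hT.exists_hasIVT_of_field
  refine ⟨K, i1, i2, ψ.comp φ, h1, h2, fun x hx => h3 _ ⟨x, hTP hx, 1, by simp, by simp⟩⟩

section IVT

variable {K : Type*} [Field K] [LinearOrder K] [IsStrictOrderedRing K]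

lemma HasIVT.mul_pos_of_no_root (hK : HasIVT K) {g : Polynomial K} {a b : K} (hab : a ≤ b)
    (h : ∀ c, a ≤ c → c ≤ b → g.eval c ≠ 0) : 0 < g.eval a * g.eval b := by
  rcases hab.eq_or_lt with rfl | hlt
  · exact mul_self_pos.2 (h a le_rfl le_rfl)
  · by_contra hcon
    have h1 : g.eval a * g.eval b < 0 := lt_of_le_of_ne (not_lt.1 hcon)
      (mul_ne_zero (h a le_rfl hab) (h b hab le_rfl))
    obtain ⟨c, h2, h3, h4⟩ := hK g a b hlt h1
    exact h c h2.le h3.le h4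

/-- Rolle's theorem for polynomials over ordered fields with the intermediate value property. -/
lemma HasIVT.rolle (hK : HasIVT K) {g : Polynomial K} (hg : g ≠ 0) {a b : K} (hab : a < b)
    (ha : g.eval a = 0) (hb : g.eval b = 0) :
    ∃ c, a < c ∧ c < b ∧ g.derivative.eval c = 0 := by
  obtain ⟨b', ⟨hab', hb'b, hb'⟩, hmin⟩ : ∃ b', (a < b' ∧ b' ≤ b ∧ g.eval b' = 0) ∧
      ∀ t, a < t → t < b' → g.eval t ≠ 0 := by
    let S := g.roots.toFinset.filter (fun t => a < t ∧ t ≤ b)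
    have hbS : b ∈ S := by simp [S, hg, hb, hab]
    have h1 := S.min'_mem ⟨b, hbS⟩
    simp only [S, Finset.mem_filter, Multiset.mem_toFinset, Polynomial.mem_roots hg,
      Polynomial.IsRoot.def] at h1
    refine ⟨_, ⟨h1.2.1, h1.2.2, h1.1⟩, fun t h2 h3 h4 => ?_⟩
    have : t ∈ S := by
      simp only [S, Finset.mem_filter, Multiset.mem_toFinset, Polynomial.mem_roots hg,
        Polynomial.IsRoot.def]
      exact ⟨h4, h2, h3.le.trans h1.2.2⟩
    exact absurd (S.min'_le t this) (not_le.2 h3)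
  suffices ∃ c, a < c ∧ c < b' ∧ g.derivative.eval c = 0 by
    obtain ⟨c, h1, h2, h3⟩ := this
    exact ⟨c, h1, h2.trans_le hb'b, h3⟩
  have factor : ∀ (p : Polynomial K) (r : K), p ≠ 0 → p.eval r = 0 →
      ∃ (k : ℕ) (q : Polynomial K), p = (Polynomial.X - Polynomial.C r) ^ (k + 1) * q ∧
        q.eval r ≠ 0 := by
    intro p r hp hr
    obtain ⟨q, h1, h2⟩ := Polynomial.exists_eq_pow_rootMultiplicity_mul_and_not_dvd p hp r
    have h3 : 0 < p.rootMultiplicity r := (Polynomial.rootMultiplicity_pos hp).2 hr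
    obtain ⟨k, hk⟩ := Nat.exists_eq_succ_of_ne_zero h3.ne'
    rw [hk] at h1
    exact ⟨k, q, h1, fun h => h2 (Polynomial.dvd_iff_isRoot.2 h)⟩
  obtain ⟨m, p, rfl, hpa⟩ := factor g a hg ha
  have hpb : p.eval b' = 0 := by
    simpa [sub_ne_zero.2 hab'.ne'] using hb'
  obtain ⟨n, q, rfl, hqb⟩ := factor p b' (right_ne_zero_of_mul hg) hpb
  have hqa : q.eval a ≠ 0 := by
    intro h
    simp [h] at hpa
  have hq : 0 < q.eval a * q.eval b' := by
    refine hK.mul_pos_of_no_root hab'.le fun c h1 h2 h3 => ?_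
    rcases h1.eq_or_lt with rfl | h1
    · exact hqa h3
    rcases h2.eq_or_lt with rfl | h2
    · exact hqb h3
    exact hmin c h1 h2 (by simp [h3])
  let R : Polynomial K := Polynomial.C ((m : K) + 1) * (Polynomial.X - Polynomial.C b') * q
    + Polynomial.C ((n : K) + 1) * (Polynomial.X - Polynomial.C a) * q
    + (Polynomial.X - Polynomial.C a) * (Polynomial.X - Polynomial.C b') * q.derivative
  have hder : ((Polynomial.X - Polynomial.C a) ^ (m + 1) *
      ((Polynomial.X - Polynomial.C b') ^ (n + 1) * q)).derivative =
      (Polynomial.X - Polynomial.C a) ^ m * (Polynomial.X - Polynomial.C b') ^ n * R := by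
    simp only [R, Polynomial.derivative_mul, Polynomial.derivative_X_sub_C_pow,
      Nat.add_sub_cancel, Nat.cast_add, Nat.cast_one, Polynomial.C_add, Polynomial.C_1,
      Polynomial.C_eq_natCast]
    ring
  have hR : R.eval a * R.eval b' < 0 := by
    have e1 : R.eval a = -(((m : K) + 1) * (b' - a) * q.eval a) := by
      simp [R]; ring
    have e2 : R.eval b' = ((n : K) + 1) * (b' - a) * q.eval b' := by
      simp [R]
    have : 0 < ((m : K) + 1) * (b' - a) * (((n : K) + 1) * (b' - a)) *
        (q.eval a * q.eval b') := by
      have := sub_pos.2 hab'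
      positivity
    rw [e1, e2]
    linarith
  obtain ⟨c, h1, h2, h3⟩ := hK R a b' hab' hR
  exact ⟨c, h1, h2, by rw [hder]; simp [h3]⟩

/-- Sign behaviour of a polynomial around a root, on an interval free of critical points. -/
lemma HasIVT.sign_around_root (hK : HasIVT K) {h : Polynomial K} {a y b : K}
    (hay : a < y) (hyb : y < b) (hy : h.eval y = 0)
    (hder : ∀ t, a < t → t < b → h.derivative.eval t ≠ 0) {t : K} (hat : a ≤ t) (htb : t ≤ b) :
    (t < y ↔ 0 < h.eval t * h.eval a) ∧ (y < t ↔ h.eval t * h.eval a < 0) := by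
  have hh : h ≠ 0 := by
    rintro rfl
    exact hder y hay hyb (by simp)
  obtain ⟨q, rfl⟩ := Polynomial.dvd_iff_isRoot.2 hy
  have hq : ∀ c, a ≤ c → c ≤ b → q.eval c ≠ 0 := by
    intro c h1 h2 h3
    rcases lt_trichotomy c y with h4 | rfl | h4
    · obtain ⟨r, h5, h6, h7⟩ := hK.rolle hh h4 (by simp [h3]) hy
      exact hder r (h1.trans_lt h5) (h6.trans hyb) h7
    · exact hder c hay hyb (by simp [Polynomial.derivative_mul, h3])
    · obtain ⟨r, h5, h6, h7⟩ := hK.rolle hh h4 hy (by simp [h3])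
      exact hder r (hay.trans h5) (h6.trans_le h2) h7
  have hpos : 0 < q.eval a * q.eval t :=
    hK.mul_pos_of_no_root hat fun c h1 h2 => hq c h1 (h2.trans htb)
  have e : ((Polynomial.X - Polynomial.C y) * q).eval t *
      ((Polynomial.X - Polynomial.C y) * q).eval a =
      (y - t) * ((y - a) * (q.eval a * q.eval t)) := by
    simp; ring
  have hpos' : 0 < (y - a) * (q.eval a * q.eval t) := mul_pos (sub_pos.2 hay) hpos
  rw [e]
  constructor
  · rw [mul_pos_iff_of_pos_right hpos', sub_pos]
  · rw [mul_neg_iff]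
    constructor
    · intro h; exact Or.inr ⟨sub_neg.2 h, hpos'⟩
    · rintro (h | h)
      · exact absurd h.2 (not_lt.2 hpos'.le)
      · exact sub_neg.1 h.1

lemma abs_root_lt (h : Polynomial K) (h0 : h ≠ 0) {y : K} (hy : h.eval y = 0) :
    |y| < 1 + ∑ i ∈ Finset.range h.natDegree, |h.coeff i / h.leadingCoeff| := by
  set d := h.natDegree with hd
  set B := ∑ i ∈ Finset.range d, |h.coeff i / h.leadingCoeff| with hB
  have hB0 : 0 ≤ B := Finset.sum_nonneg fun i _ => abs_nonneg _
  by_contra hcon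
  push Not at hcon
  have hy1 : 1 ≤ |y| := by linarith
  have hl : h.leadingCoeff ≠ 0 := Polynomial.leadingCoeff_ne_zero.2 h0
  have hdpos : d ≠ 0 := by
    intro hd0
    obtain ⟨u, rfl⟩ := Polynomial.natDegree_eq_zero.1 (hd.symm.trans hd0)
    simp at hy
    simp [hy] at h0
  have e : y ^ d = -∑ i ∈ Finset.range d, h.coeff i / h.leadingCoeff * y ^ i := by
    rw [Polynomial.eval_eq_sum_range, Finset.sum_range_succ, ← hd] at hy
    have h2 : h.coeff d = h.leadingCoeff := rfl
    rw [h2] at hy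
    have h3 : ∑ i ∈ Finset.range d, h.coeff i / h.leadingCoeff * y ^ i =
        (∑ i ∈ Finset.range d, h.coeff i * y ^ i) / h.leadingCoeff := by
      rw [Finset.sum_div]
      exact Finset.sum_congr rfl fun i _ => by ring
    rw [h3]
    field_simp
    linear_combination hy
  have h1 : |y| ^ d ≤ B * |y| ^ (d - 1) := by
    rw [← abs_pow, e, abs_neg, hB, Finset.sum_mul]
    refine (Finset.abs_sum_le_sum_abs _ _).trans (Finset.sum_le_sum fun i hi => ?_)
    rw [abs_mul, abs_pow]
    refine mul_le_mul_of_nonneg_left (pow_le_pow_right₀ hy1 ?_) (abs_nonneg _)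
    have := Finset.mem_range.1 hi
    omega
  have h2 : |y| ^ d = |y| * |y| ^ (d - 1) := by
    rw [← pow_succ']; congr 1; omega
  rw [h2] at h1
  have h3 : 0 < |y| ^ (d - 1) := by positivity
  have := le_of_mul_le_mul_right h1 h3
  linarith

end IVT

section Transfer

lemma pos_map_iff {G K : Type*} [Field G] [LinearOrder G] [Field K] [LinearOrder K]
    {α : G →+* K} (hα : StrictMono α) (x : G) : 0 < α x ↔ 0 < x := by
  simpa using hα.lt_iff_lt (a := 0) (b := x)

lemma neg_map_iff {G K : Type*} [Field G] [LinearOrder G] [Field K] [LinearOrder K]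
    {α : G →+* K} (hα : StrictMono α) (x : G) : α x < 0 ↔ x < 0 := by
  simpa using hα.lt_iff_lt (a := x) (b := 0)

/-- An element outside the image is separated from finitely many elements by an element
of the smaller field. -/
lemma exists_same_cut {G K : Type*} [Field G] [LinearOrder G] [IsStrictOrderedRing G]
    [Field K] [LinearOrder K] {α : G →+* K} (hα : StrictMono α) (S : Finset G) (y : K) :
    ∃ c, ∀ e ∈ S, (α e < y → e < c) ∧ (y < α e → c < e) := by
  obtain ⟨c, h1, h2⟩ := Order.exists_between_finsets (S.filter (α · < y)) (S.filter (y < α ·))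
    (fun a ha b hb => hα.lt_iff_lt.1
      ((Finset.mem_filter.1 ha).2.trans (Finset.mem_filter.1 hb).2))
  exact ⟨c, fun e he => ⟨fun h => h1 e (Finset.mem_filter.2 ⟨he, h⟩),
    fun h => h2 e (Finset.mem_filter.2 ⟨he, h⟩)⟩⟩
lemma eval₂_pos_iff_of_cut {G K : Type*} [Field G] [LinearOrder G] [Field K] [LinearOrder K]
    [IsStrictOrderedRing K] (hK : HasIVT K) {α : G →+* K} (hα : StrictMono α)
    {r : Polynomial G} (hroots : ∀ y, r.eval₂ α y = 0 → y ∈ Set.range α)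
    {y : K} (hy : y ∉ Set.range α) {c : G}
    (hc : ∀ e, r.eval e = 0 → (α e < y → e < c) ∧ (y < α e → c < e)) :
    0 < r.eval₂ α y ↔ 0 < r.eval c := by
  have h0 : ∀ z, (r.map α).eval z = 0 → ∃ e, r.eval e = 0 ∧ z = α e := by
    intro z hz
    rw [Polynomial.eval_map] at hz
    obtain ⟨e, rfl⟩ := hroots z hz
    rw [Polynomial.eval₂_at_apply] at hz
    exact ⟨e, (map_eq_zero α).1 hz, rfl⟩
  have hprod : 0 < (r.map α).eval (α c) * (r.map α).eval y := by
    rcases le_total (α c) y with h | h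
    · refine hK.mul_pos_of_no_root h fun z h1 h2 h3 => ?_
      obtain ⟨e, he, rfl⟩ := h0 z h3
      have h4 := (hc e he).1 (lt_of_le_of_ne h2 fun h => hy ⟨e, h⟩)
      exact absurd (hα h4) (not_lt.2 h1)
    · rw [mul_comm]
      refine hK.mul_pos_of_no_root h fun z h1 h2 h3 => ?_
      obtain ⟨e, he, rfl⟩ := h0 z h3
      have h4 := (hc e he).2 (lt_of_le_of_ne h1 fun h => hy ⟨e, h.symm⟩)
      exact absurd (hα h4) (not_lt.2 h2)
  rw [Polynomial.eval_map, Polynomial.eval_map, Polynomial.eval₂_at_apply] at hprod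
  rw [← pos_map_iff hα]
  constructor
  · intro h
    exact (pos_iff_pos_of_mul_pos hprod).2 h
  · intro h
    exact (pos_iff_pos_of_mul_pos hprod).1 h

variable {G K U : Type*} [Field G] [LinearOrder G] [IsStrictOrderedRing G]
  [Field K] [LinearOrder K] [IsStrictOrderedRing K]
  [Field U] [LinearOrder U] [IsStrictOrderedRing U]

/-- All roots in the larger field of polynomials of degree less than `d` lie in the
smaller field. -/
def RootsIn {G K : Type*} [Field G] [Field K] (α : G →+* K) (d : ℕ) : Prop :=
  ∀ g : Polynomial G, g ≠ 0 → g.natDegree < d → ∀ y, g.eval₂ α y = 0 → y ∈ Set.range α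

lemma eval₂_pos_iff_of_same_cut (hK : HasIVT K) (hU : HasIVT U) {α : G →+* K} {β : G →+* U}
    (hα : StrictMono α) (hβ : StrictMono β) {d : ℕ} (hαd : RootsIn α d) (hβd : RootsIn β d)
    {y : K} {y' : U} (hcut : ∀ e, (α e < y ↔ β e < y') ∧ (y < α e ↔ y' < β e))
    {r : Polynomial G} (hr : r.natDegree < d) : 0 < r.eval₂ α y ↔ 0 < r.eval₂ β y' := by
  rcases eq_or_ne r 0 with rfl | hr0
  · simp
  by_cases hy : y ∈ Set.range α
  · obtain ⟨e, rfl⟩ := hy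
    have h1 := hcut e
    simp only [lt_irrefl, false_iff, not_lt] at h1
    rw [le_antisymm h1.1 h1.2, Polynomial.eval₂_at_apply, Polynomial.eval₂_at_apply,
      pos_map_iff hα, pos_map_iff hβ]
  · have hy' : y' ∉ Set.range β := by
      rintro ⟨e, rfl⟩
      have h1 := hcut e
      simp only [lt_irrefl, iff_false, not_lt] at h1
      exact hy ⟨e, le_antisymm h1.2 h1.1⟩
    obtain ⟨c, hc⟩ := exists_same_cut hα r.roots.toFinset y
    have hc' : ∀ e, r.eval e = 0 → (α e < y → e < c) ∧ (y < α e → c < e) := fun e he =>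
      hc e (by simpa [hr0] using he)
    rw [eval₂_pos_iff_of_cut hK hα (hαd r hr0 hr) hy hc',
      eval₂_pos_iff_of_cut hU hβ (hβd r hr0 hr) hy' (c := c) fun e he => by
        rw [← (hcut e).1, ← (hcut e).2]; exact hc' e he]

lemma exists_bracket {α : G →+* K} (S : Finset G) {M : G} {y : K}
    (hM : |y| < α M) (hy : y ∉ Set.range α) :
    ∃ a b, α a < y ∧ y < α b ∧ ∀ e ∈ S, ¬ (a < e ∧ e < b) := by
  let S' := insert M (insert (-M) S)
  have hne1 : (S'.filter (α · < y)).Nonempty :=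
    ⟨-M, by simp only [S', Finset.mem_filter, Finset.mem_insert, map_neg]
            exact ⟨by simp, (abs_lt.1 hM).1⟩⟩
  have hne2 : (S'.filter (y < α ·)).Nonempty :=
    ⟨M, by simp only [S', Finset.mem_filter, Finset.mem_insert]
           exact ⟨by simp, (abs_lt.1 hM).2⟩⟩
  refine ⟨_, _, (Finset.mem_filter.1 (Finset.max'_mem _ hne1)).2,
    (Finset.mem_filter.1 (Finset.min'_mem _ hne2)).2, fun e he hlt => ?_⟩
  have heS : e ∈ S' := by simp [S', he]
  rcases lt_trichotomy (α e) y with h | h | h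
  · exact absurd hlt.1 (not_lt.2 (Finset.le_max' _ _ (Finset.mem_filter.2 ⟨heS, h⟩)))
  · exact hy ⟨e, h⟩
  · exact absurd hlt.2 (not_lt.2 (Finset.min'_le _ _ (Finset.mem_filter.2 ⟨heS, h⟩)))

/-- A root in `K` of a polynomial over `G` has a counterpart of the same type over `G` in `U`. -/
lemma exists_same_type_of_root (hK : HasIVT K) (hU : HasIVT U) {α : G →+* K} {β : G →+* U}
    (hα : StrictMono α) (hβ : StrictMono β) {d : ℕ} (hαd : RootsIn α d) (hβd : RootsIn β d)
    {h : Polynomial G} (h0 : h ≠ 0) (hd : h.natDegree = d) {y : K} (hy : h.eval₂ α y = 0) :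
    ∃ y' : U, ∀ k : Polynomial G, 0 < k.eval₂ α y ↔ 0 < k.eval₂ β y' := by
  by_cases hyr : y ∈ Set.range α
  · obtain ⟨e, rfl⟩ := hyr
    refine ⟨β e, fun k => ?_⟩
    rw [Polynomial.eval₂_at_apply, Polynomial.eval₂_at_apply, pos_map_iff hα, pos_map_iff hβ]
  have hd0 : h.natDegree ≠ 0 := by
    intro h1
    obtain ⟨u, rfl⟩ := Polynomial.natDegree_eq_zero.1 h1
    simp at hy
    simp [hy] at h0
  have hder0 : h.derivative ≠ 0 := fun h1 =>
    hd0 (Polynomial.derivative_eq_zero.1 h1)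
  have hderd : h.derivative.natDegree < d := hd ▸ Polynomial.natDegree_derivative_lt hd0
  have hMex : ∃ M : G, |y| < α M := by
    have h1 := abs_root_lt (h.map α) (by simpa using h0) (y := y)
      (by rw [Polynomial.eval_map]; exact hy)
    refine ⟨1 + ∑ i ∈ Finset.range h.natDegree, |h.coeff i / h.leadingCoeff|, ?_⟩
    have habs : ∀ x : G, α |x| = |α x| := by
      intro x
      rcases abs_cases x with ⟨e, hx⟩ | ⟨e, hx⟩
      · rw [e, abs_of_nonneg]
        have := (neg_map_iff hα x).not.2 (not_lt.2 hx)
        exact not_lt.1 this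
      · rw [e, abs_of_neg ((neg_map_iff hα x).2 hx), map_neg]
    simpa [habs, Polynomial.natDegree_map, Polynomial.leadingCoeff_map] using h1
  obtain ⟨M, hM⟩ := hMex
  obtain ⟨a, b, hay, hyb, hno⟩ := exists_bracket h.derivative.roots.toFinset hM hyr
  have hno' : ∀ e, a < e → e < b → h.derivative.eval e ≠ 0 := by
    intro e h1 h2 h3
    exact hno e (by simpa [hder0] using h3) ⟨h1, h2⟩
  have hderK : ∀ t, α a < t → t < α b → (h.map α).derivative.eval t ≠ 0 := by
    intro t h1 h2 h3
    rw [Polynomial.derivative_map, Polynomial.eval_map] at h3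
    obtain ⟨e, rfl⟩ := hαd _ hder0 hderd t h3
    rw [Polynomial.eval₂_at_apply, map_eq_zero] at h3
    exact hno' e (hα.lt_iff_lt.1 h1) (hα.lt_iff_lt.1 h2) h3
  have hderU : ∀ t, β a < t → t < β b → (h.map β).derivative.eval t ≠ 0 := by
    intro t h1 h2 h3
    rw [Polynomial.derivative_map, Polynomial.eval_map] at h3
    obtain ⟨e, rfl⟩ := hβd _ hder0 hderd t h3
    rw [Polynomial.eval₂_at_apply, map_eq_zero] at h3
    exact hno' e (hβ.lt_iff_lt.1 h1) (hβ.lt_iff_lt.1 h2) h3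
  have hyK : (h.map α).eval y = 0 := by rw [Polynomial.eval_map]; exact hy
  have hab : a < b := hα.lt_iff_lt.1 (hay.trans hyb)
  have eα : ∀ e, (h.map α).eval (α e) = α (h.eval e) := fun e => by
    rw [Polynomial.eval_map, Polynomial.eval₂_at_apply]
  have eβ : ∀ e, (h.map β).eval (β e) = β (h.eval e) := fun e => by
    rw [Polynomial.eval_map, Polynomial.eval₂_at_apply]
  have hsK : ∀ e, a ≤ e → e ≤ b → (α e < y ↔ 0 < h.eval e * h.eval a) ∧
      (y < α e ↔ h.eval e * h.eval a < 0) := by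
    intro e h1 h2
    have := hK.sign_around_root hay hyb hyK hderK (hα.monotone h1) (hα.monotone h2)
    rwa [eα, eα, ← map_mul, pos_map_iff hα, neg_map_iff hα] at this
  obtain ⟨y', hay', hyb', hy'⟩ := hU (h.map β) (β a) (β b) (hβ hab) (by
    rw [eβ, eβ, ← map_mul, neg_map_iff hβ, mul_comm]
    exact (hsK b hab.le le_rfl).2.1 hyb)
  have hsU : ∀ e, a ≤ e → e ≤ b → (β e < y' ↔ 0 < h.eval e * h.eval a) ∧
      (y' < β e ↔ h.eval e * h.eval a < 0) := by
    intro e h1 h2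
    have := hU.sign_around_root hay' hyb' hy' hderU (hβ.monotone h1) (hβ.monotone h2)
    rwa [eβ, eβ, ← map_mul, pos_map_iff hβ, neg_map_iff hβ] at this
  have hcut : ∀ e, (α e < y ↔ β e < y') ∧ (y < α e ↔ y' < β e) := by
    intro e
    rcases lt_or_ge e a with h1 | h1
    · have h2 := (hα h1).trans hay
      have h3 := (hβ h1).trans hay'
      simp [h2, h3, h2.not_gt, h3.not_gt]
    rcases lt_or_ge b e with h4 | h4
    · have h2 := hyb.trans (hα h4)
      have h3 := hyb'.trans (hβ h4)
      simp [h2, h3, h2.not_gt, h3.not_gt]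
    rw [(hsK e h1 h4).1, (hsK e h1 h4).2, (hsU e h1 h4).1, (hsU e h1 h4).2]
    simp
  refine ⟨y', fun k => ?_⟩
  have e1 : k.eval₂ α y = (k % h).eval₂ α y := by
    conv_lhs => rw [← EuclideanDomain.mod_add_div k h]
    rw [Polynomial.eval₂_add, Polynomial.eval₂_mul, hy, zero_mul, add_zero]
  have e2 : k.eval₂ β y' = (k % h).eval₂ β y' := by
    conv_lhs => rw [← EuclideanDomain.mod_add_div k h]
    rw [Polynomial.eval_map] at hy'
    rw [Polynomial.eval₂_add, Polynomial.eval₂_mul, hy', zero_mul, add_zero]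
  rw [e1, e2]
  exact eval₂_pos_iff_of_same_cut hK hU hα hβ hαd hβd hcut
    (hd ▸ Polynomial.natDegree_mod_lt k hd0)

end Transfer

section Maximal

variable {K U : Type} [Field K] [LinearOrder K] [IsStrictOrderedRing K]
  [Field U] [LinearOrder U] [IsStrictOrderedRing U]

/-- A subring of a product of two ordered fields whose elements have the same sign
in both coordinates. -/
def SameSign (Γ : Subring (K × U)) : Prop := ∀ z ∈ Γ, 0 < z.1 ↔ 0 < z.2

omit [IsStrictOrderedRing U] [IsStrictOrderedRing K] in
lemma exists_maximal_sameSign {Γ₀ : Subring (K × U)} (h₀ : SameSign Γ₀) :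
    ∃ Γ, Γ₀ ≤ Γ ∧ Maximal SameSign Γ := by
  refine zorn_le_nonempty₀ {Γ | SameSign Γ} (fun c hc hch y hy => ?_) Γ₀ h₀
  refine ⟨sSup c, fun z hz => ?_, fun z hz => le_sSup hz⟩
  obtain ⟨Γ, hΓ, hz⟩ := (Subring.mem_sSup_of_directedOn ⟨y, hy⟩ hch.directedOn).1 hz
  exact hc hΓ z hz

lemma SameSign.neg {Γ : Subring (K × U)} (h : SameSign Γ) {z : K × U} (hz : z ∈ Γ) :
    z.1 < 0 ↔ z.2 < 0 := by
  simpa using h (-z) (neg_mem hz)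

lemma SameSign.eq_zero {Γ : Subring (K × U)} (h : SameSign Γ) {z : K × U} (hz : z ∈ Γ) :
    z.1 = 0 ↔ z.2 = 0 := by
  have h1 := h z hz
  have h2 := h.neg hz
  constructor
  · intro h3
    simp only [h3, lt_irrefl, false_iff, not_lt] at h1 h2
    exact le_antisymm h1 h2
  · intro h3
    simp only [h3, lt_irrefl, iff_false, not_lt] at h1 h2
    exact le_antisymm h1 h2

/-- The fractions of elements of a subring of a product of two fields. -/
def fractionSubring (Γ : Subring (K × U)) : Subring (K × U) where
  carrier := {z | ∃ a ∈ Γ, ∃ b ∈ Γ, b.1 ≠ 0 ∧ z * b = a}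
  mul_mem' := by
    rintro x y ⟨a, ha, b, hb, h1, h2⟩ ⟨a', ha', b', hb', h1', h2'⟩
    exact ⟨a * a', mul_mem ha ha', b * b', mul_mem hb hb', by simp [h1, h1'], by
      rw [← h2, ← h2']; ring⟩
  one_mem' := ⟨1, one_mem _, 1, one_mem _, by simp, by simp⟩
  add_mem' := by
    rintro x y ⟨a, ha, b, hb, h1, h2⟩ ⟨a', ha', b', hb', h1', h2'⟩
    exact ⟨a * b' + a' * b, add_mem (mul_mem ha hb') (mul_mem ha' hb), b * b', mul_mem hb hb',
      by simp [h1, h1'], by rw [← h2, ← h2']; ring⟩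
  zero_mem' := ⟨0, zero_mem _, 1, one_mem _, by simp, by simp⟩
  neg_mem' := by
    rintro x ⟨a, ha, b, hb, h1, h2⟩
    exact ⟨-a, neg_mem ha, b, hb, h1, by rw [← h2]; ring⟩

lemma isField_of_maximal {Γ : Subring (K × U)} (hΓ : Maximal SameSign Γ) : IsField Γ := by
  have hs : SameSign Γ := hΓ.prop
  have h1 : SameSign (fractionSubring Γ) := by
    rintro z ⟨a, ha, b, hb, hb0, e⟩
    have hb1 : b.2 ≠ 0 := fun h => hb0 ((hs.eq_zero hb).2 h)
    have e1 : z.1 * b.1 ^ 2 = (a * b).1 := by rw [← e]; simp; ring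
    have e2 : z.2 * b.2 ^ 2 = (a * b).2 := by rw [← e]; simp; ring
    have h3 : 0 < b.1 ^ 2 := by positivity
    have h4 : 0 < b.2 ^ 2 := by positivity
    rw [← mul_pos_iff_of_pos_right h3, ← mul_pos_iff_of_pos_right h4, e1, e2]
    exact hs _ (mul_mem ha hb)
  have h2 : fractionSubring Γ ≤ Γ :=
    hΓ.le_of_ge h1 fun z hz => ⟨z, hz, 1, one_mem _, by simp, by simp⟩
  refine ⟨⟨0, 1, fun h => zero_ne_one (α := K) (congrArg (fun z : Γ => (z : K × U).1) h)⟩,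
    mul_comm, fun {a} ha => ?_⟩
  have ha1 : (a : K × U).1 ≠ 0 := by
    intro h
    have := (hs.eq_zero a.2).1 h
    exact ha (Subtype.ext (Prod.ext h this))
  have ha2 : (a : K × U).2 ≠ 0 := fun h => ha1 ((hs.eq_zero a.2).2 h)
  refine ⟨⟨((a : K × U).1⁻¹, (a : K × U).2⁻¹), h2 ⟨1, one_mem _, a, a.2, ha1, ?_⟩⟩, ?_⟩
  · exact Prod.ext (inv_mul_cancel₀ ha1) (inv_mul_cancel₀ ha2)
  · exact Subtype.ext (Prod.ext (mul_inv_cancel₀ ha1) (mul_inv_cancel₀ ha2))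

/-- Two ordered field extensions of a ring inducing the same signs share an intermediate
field which is maximal with this property. -/
lemma exists_common_maximal_field {G₀ : Type*} [CommRing G₀]
    (α₀ : G₀ →+* K) (β₀ : G₀ →+* U) (h : ∀ x, 0 < α₀ x ↔ 0 < β₀ x) :
    ∃ (G : Type) (_ : Field G) (α : G →+* K) (β : G →+* U) (ι : G₀ →+* G),
      (∀ x, 0 < α x ↔ 0 < β x) ∧ α.comp ι = α₀ ∧ β.comp ι = β₀ ∧
      ∀ (y : K) (y' : U), (∀ k : Polynomial G, 0 < k.eval₂ α y ↔ 0 < k.eval₂ β y') →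
        y ∈ Set.range α ∧ y' ∈ Set.range β := by
  obtain ⟨Γ, hle, hΓ⟩ := exists_maximal_sameSign (Γ₀ := (α₀.prod β₀).range) (by
    rintro _ ⟨x, rfl⟩
    exact h x)
  have hs : SameSign Γ := hΓ.prop
  let : Field Γ := (isField_of_maximal hΓ).toField
  let α : Γ →+* K := (RingHom.fst K U).comp Γ.subtype
  let β : Γ →+* U := (RingHom.snd K U).comp Γ.subtype
  refine ⟨Γ, inferInstance, α, β, (α₀.prod β₀).codRestrict Γ (fun x => hle ⟨x, rfl⟩),
    fun x => hs x x.2, RingHom.ext fun _ => rfl, RingHom.ext fun _ => rfl, fun y y' hk => ?_⟩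
  let ev : Polynomial Γ →+* K × U := Polynomial.eval₂RingHom Γ.subtype (y, y')
  have h1 : SameSign ev.range := by
    rintro _ ⟨k, rfl⟩
    have e1 : (ev k).1 = k.eval₂ α y :=
      Polynomial.hom_eval₂ k Γ.subtype (RingHom.fst K U) (y, y')
    have e2 : (ev k).2 = k.eval₂ β y' :=
      Polynomial.hom_eval₂ k Γ.subtype (RingHom.snd K U) (y, y')
    rw [e1, e2]
    exact hk k
  have h2 : ev.range ≤ Γ := hΓ.le_of_ge h1 fun z hz =>
    ⟨Polynomial.C ⟨z, hz⟩, by simp [ev]⟩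
  have h3 : (y, y') ∈ Γ := h2 ⟨Polynomial.X, by simp [ev]⟩
  exact ⟨⟨⟨_, h3⟩, rfl⟩, ⟨⟨_, h3⟩, rfl⟩⟩

/-- Two ordered field extensions of a ring inducing the same signs share an intermediate
ordered field closed under taking roots in either extension. -/
lemma exists_common_closed_field (hK : HasIVT K) (hU : HasIVT U) {G₀ : Type*} [CommRing G₀]
    (α₀ : G₀ →+* K) (β₀ : G₀ →+* U) (h : ∀ x, 0 < α₀ x ↔ 0 < β₀ x) :
    ∃ (G : Type) (_ : Field G) (_ : LinearOrder G) (_ : IsStrictOrderedRing G)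
      (α : G →+* K) (β : G →+* U) (ι : G₀ →+* G),
      StrictMono α ∧ StrictMono β ∧ (∀ d, RootsIn α d) ∧ α.comp ι = α₀ ∧ β.comp ι = β₀ := by
  obtain ⟨G, _, α, β, ι, hαβ, hα₀, hβ₀, hmax⟩ := exists_common_maximal_field α₀ β₀ h
  let : LinearOrder G := LinearOrder.lift' α α.injective
  have hα : StrictMono α := fun _ _ h => h
  have : IsStrictOrderedRing G := Function.Injective.isStrictOrderedRing α (map_zero _)
    (map_one _) (map_add _) (map_mul _) Iff.rfl Iff.rfl
  have hβ : StrictMono β := by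
    intro x y hxy
    have h1 : 0 < α (y - x) := by rw [map_sub]; exact sub_pos.2 (hα hxy)
    have h2 := (hαβ _).1 h1
    rwa [map_sub, sub_pos] at h2
  have hroots : ∀ d, RootsIn α d ∧ RootsIn β d := by
    intro d
    induction d with
    | zero => exact ⟨fun g _ h => absurd h (Nat.not_lt_zero _),
        fun g _ h => absurd h (Nat.not_lt_zero _)⟩
    | succ d ih =>
      constructor
      · intro g hg hgd y hy
        rcases (Nat.lt_succ_iff.1 hgd).lt_or_eq with hlt | heq
        · exact ih.1 g hg hlt y hy
        obtain ⟨y', hy'⟩ := exists_same_type_of_root hK hU hα hβ ih.1 ih.2 hg heq hy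
        exact (hmax y y' hy').1
      · intro g hg hgd y hy
        rcases (Nat.lt_succ_iff.1 hgd).lt_or_eq with hlt | heq
        · exact ih.2 g hg hlt y hy
        obtain ⟨y', hy'⟩ := exists_same_type_of_root hU hK hβ hα ih.2 ih.1 hg heq hy
        exact (hmax y' y fun k => (hy' k).symm).2
  exact ⟨G, inferInstance, inferInstance, inferInstance, α, β, ι, hα, hβ,
    fun d => (hroots d).1, hα₀, hβ₀⟩

end Maximal

section Ultrapower

variable {ι U : Type} [Field U] [LinearOrder U]

open Filter in
lemma hasIVT_germ (hU : HasIVT U) (φ : Ultrafilter ι) : HasIVT ((φ : Filter ι).Germ U) := by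
  intro g a b hab hlt
  obtain ⟨p, rfl⟩ := Polynomial.map_surjective (Germ.coeRingHom (φ : Filter ι))
    (fun x => Germ.inductionOn x fun f => ⟨f, rfl⟩) g
  induction a using Germ.inductionOn with | _ a
  induction b using Germ.inductionOn with | _ b
  have hev : ∀ c : ι → U, (p.map (Germ.coeRingHom (φ : Filter ι))).eval
      (c : (φ : Filter ι).Germ U) =
      ((fun i => (p.map (Pi.evalRingHom (fun _ => U) i)).eval (c i) : ι → U) :
        (φ : Filter ι).Germ U) := by
    intro c
    have h1 : (fun i => (p.map (Pi.evalRingHom (fun _ => U) i)).eval (c i)) = p.eval c := by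
      ext i
      exact Polynomial.eval_map_apply (Pi.evalRingHom (fun _ => U) i) c
    rw [h1]
    exact Polynomial.eval_map_apply (Germ.coeRingHom (φ : Filter ι)) c
  have h1 : ∀ᶠ i in (φ : Filter ι), a i < b i := Germ.coe_lt.1 hab
  rw [hev, hev] at hlt
  have h2 : ∀ᶠ i in (φ : Filter ι), (p.map (Pi.evalRingHom (fun _ => U) i)).eval (a i) *
      (p.map (Pi.evalRingHom (fun _ => U) i)).eval (b i) < 0 := Germ.coe_lt.1 hlt
  have h3 : ∀ i, ∃ c, a i < b i → (p.map (Pi.evalRingHom (fun _ => U) i)).eval (a i) *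
      (p.map (Pi.evalRingHom (fun _ => U) i)).eval (b i) < 0 →
      a i < c ∧ c < b i ∧ (p.map (Pi.evalRingHom (fun _ => U) i)).eval c = 0 := by
    intro i
    by_cases h : a i < b i ∧ (p.map (Pi.evalRingHom (fun _ => U) i)).eval (a i) *
      (p.map (Pi.evalRingHom (fun _ => U) i)).eval (b i) < 0
    · obtain ⟨c, hc⟩ := hU _ _ _ h.1 h.2
      exact ⟨c, fun _ _ => hc⟩
    · exact ⟨0, fun h1 h2 => absurd ⟨h1, h2⟩ h⟩
  choose c hc using h3
  refine ⟨(c : (φ : Filter ι).Germ U), Germ.coe_lt.2 ?_, Germ.coe_lt.2 ?_, ?_⟩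
  · filter_upwards [h1, h2] with i h1 h2 using (hc i h1 h2).1
  · filter_upwards [h1, h2] with i h1 h2 using (hc i h1 h2).2.1
  · rw [hev]
    refine Germ.coe_eq.2 ?_
    filter_upwards [h1, h2] with i h1 h2 using (hc i h1 h2).2.2

/-- Finite systems of real polynomial inequalities solvable in `U` are solvable over `ℝ`. -/
def SpecializesToReal (j : ℝ →+* U) : Prop :=
  ∀ (σ : Type) (J : Finset (MvPolynomial σ ℝ)) (w : σ → U), (∀ P ∈ J, 0 ≤ eval₂ j w P) →
    ∃ b : σ → ℝ, ∀ P ∈ J, 0 ≤ eval b P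

open Filter in
lemma SpecializesToReal.germ {j : ℝ →+* U} (hj : SpecializesToReal j) (φ : Ultrafilter ι) :
    SpecializesToReal (((Germ.coeRingHom (φ : Filter ι)).comp
      (Pi.constRingHom ι U)).comp j) := by
  intro σ J w hw
  have h1 : ∀ s, ∃ f : ι → U, w s = (f : (φ : Filter ι).Germ U) := fun s =>
    Germ.inductionOn (w s) fun f => ⟨f, rfl⟩
  choose f hf using h1
  have h2 : ∀ P : MvPolynomial σ ℝ, eval₂ (((Germ.coeRingHom (φ : Filter ι)).comp
      (Pi.constRingHom ι U)).comp j) w P =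
      ((fun i => eval₂ j (fun s => f s i) P : ι → U) : (φ : Filter ι).Germ U) := by
    intro P
    let F : MvPolynomial σ ℝ →+* (ι → U) :=
      RingHom.pi fun i => eval₂Hom j (fun s => f s i)
    have : eval₂Hom (((Germ.coeRingHom (φ : Filter ι)).comp (Pi.constRingHom ι U)).comp j) w =
        (Germ.coeRingHom (φ : Filter ι)).comp F := by
      refine MvPolynomial.ringHom_ext (fun r => ?_) (fun s => ?_)
      · simp only [eval₂Hom_C, RingHom.comp_apply]
        congr 1
        ext i
        exact (eval₂_C j _ r).symm
      · simp only [eval₂Hom_X', RingHom.comp_apply, hf]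
        change _ = ((F (X s) : ι → U) : (φ : Filter ι).Germ U)
        congr 1
        ext i
        exact (eval₂_X j (fun s => f s i) s).symm
    exact congrArg (fun g => g P) this
  have h3 : ∀ᶠ i in (φ : Filter ι), ∀ P ∈ J, 0 ≤ eval₂ j (fun s => f s i) P := by
    rw [Filter.eventually_all_finset]
    intro P hP
    have := hw P hP
    rw [h2] at this
    exact Germ.coe_le.1 this
  obtain ⟨i, hi⟩ := h3.exists
  exact hj σ J _ hi

end Ultrapower

section

variable {G K U : Type} [Field G] [LinearOrder G] [IsStrictOrderedRing G]
  [Field K] [LinearOrder K] [IsStrictOrderedRing K]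
  [Field U] [LinearOrder U] [IsStrictOrderedRing U]

lemma exists_same_signs (hK : HasIVT K) {α : G →+* K} (hα : StrictMono α)
    (hroots : ∀ d, RootsIn α d) (x : K) (T : Finset (Polynomial G)) :
    ∃ c : G, ∀ k ∈ T, 0 < k.eval₂ α x ↔ 0 < k.eval c := by
  by_cases hx : x ∈ Set.range α
  · obtain ⟨c, rfl⟩ := hx
    refine ⟨c, fun k _ => ?_⟩
    rw [Polynomial.eval₂_at_apply, pos_map_iff hα]
  · obtain ⟨c, hc⟩ := exists_same_cut hα (T.biUnion fun k => k.roots.toFinset) x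
    refine ⟨c, fun k hk => ?_⟩
    rcases eq_or_ne k 0 with rfl | hk0
    · simp
    · refine eval₂_pos_iff_of_cut hK hα (hroots _ k hk0 (Nat.lt_succ_self _)) hx fun e he =>
        hc e ?_
      simp only [Finset.mem_biUnion, Multiset.mem_toFinset]
      exact ⟨k, hk, by simpa [hk0] using he⟩

open Filter in
/-- After passing to an ultrapower, every element of `K` has a counterpart of the same type. -/
lemma exists_same_type_ultrapower (hK : HasIVT K) (hU : HasIVT U) {α : G →+* K} {β : G →+* U}
    (hα : StrictMono α) (hβ : StrictMono β) (hroots : ∀ d, RootsIn α d) {j : ℝ →+* U}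
    (hj : SpecializesToReal j) (x : K) :
    ∃ (V : Type) (_ : Field V) (_ : LinearOrder V) (_ : IsStrictOrderedRing V)
      (e : U →+* V) (x' : V), HasIVT V ∧ SpecializesToReal (e.comp j) ∧
      ∀ k : Polynomial G, 0 < k.eval₂ α x ↔ 0 < k.eval₂ (e.comp β) x' := by
  choose c hc using exists_same_signs hK hα hroots x
  let φ : Ultrafilter (Finset (Polynomial G)) := Ultrafilter.of atTop
  refine ⟨(φ : Filter (Finset (Polynomial G))).Germ U, inferInstance, inferInstance,
    inferInstance,
    (Germ.coeRingHom (φ : Filter (Finset (Polynomial G)))).comp (Pi.constRingHom _ U),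
    ((fun T => β (c T) : Finset (Polynomial G) → U) :
      (φ : Filter (Finset (Polynomial G))).Germ U), hasIVT_germ hU φ, ?_, fun k => ?_⟩
  · exact hj.germ φ
  have e1 : k.eval₂ (((Germ.coeRingHom (φ : Filter (Finset (Polynomial G)))).comp
        (Pi.constRingHom _ U)).comp β)
      ((fun T => β (c T) : Finset (Polynomial G) → U) :
        (φ : Filter (Finset (Polynomial G))).Germ U) =
      ((fun T => β (k.eval (c T)) : Finset (Polynomial G) → U) :
        (φ : Filter (Finset (Polynomial G))).Germ U) := by
    have h1 := Polynomial.hom_eval₂ k ((Pi.constRingHom (Finset (Polynomial G)) U).comp β)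
      (Germ.coeRingHom (φ : Filter (Finset (Polynomial G)))) (fun T => β (c T))
    refine h1.symm.trans ?_
    change ((_ : Finset (Polynomial G) → U) : (φ : Filter (Finset (Polynomial G))).Germ U) = _
    congr 1
    ext T
    have h2 := Polynomial.hom_eval₂ k ((Pi.constRingHom (Finset (Polynomial G)) U).comp β)
      (Pi.evalRingHom (fun _ => U) T) (fun T => β (c T))
    refine h2.trans ?_
    exact Polynomial.eval₂_at_apply β (c T)
  have hmem : ∀ᶠ T in (φ : Filter (Finset (Polynomial G))), k ∈ T := by
    refine Ultrafilter.of_le atTop ?_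
    filter_upwards [eventually_ge_atTop {k}] with T hT using hT (by simp)
  rw [e1]
  refine Iff.trans ?_ (Germ.coe_lt (f := fun _ => (0 : U))).symm
  constructor
  · intro h
    filter_upwards [hmem] with T hT
    rw [pos_map_iff hβ]
    exact (hc T k hT).1 h
  · intro h
    obtain ⟨T, h1, h2⟩ := (h.and hmem).exists
    rw [pos_map_iff hβ] at h1
    exact (hc T k h2).2 h1

end

lemma hasIVT_real : HasIVT ℝ := by
  intro g a b hab hlt
  have hcont : ContinuousOn (fun x => g.eval x) (Set.Icc a b) := g.continuous.continuousOn
  rcases mul_neg_iff.1 hlt with ⟨h1, h2⟩ | ⟨h1, h2⟩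
  · obtain ⟨c, hc, h3⟩ := intermediate_value_Ioo' hab.le hcont ⟨h2, h1⟩
    exact ⟨c, hc.1, hc.2, h3⟩
  · obtain ⟨c, hc, h3⟩ := intermediate_value_Ioo hab.le hcont ⟨h1, h2⟩
    exact ⟨c, hc.1, hc.2, h3⟩

lemma real_map_pos_iff {K : Type*} [Field K] [LinearOrder K] [IsStrictOrderedRing K]
    (j : ℝ →+* K) (x : ℝ) : 0 < j x ↔ 0 < x := by
  have h1 : ∀ x : ℝ, 0 ≤ x → 0 ≤ j x := fun x hx => by
    rw [← Real.sq_sqrt hx, map_pow]; positivity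
  constructor
  · intro h
    by_contra hx
    have := h1 (-x) (by linarith)
    rw [map_neg] at this
    linarith
  · intro h
    exact lt_of_le_of_ne (h1 x h.le) ((map_ne_zero j).2 h.ne').symm

/-- Finite systems of real polynomial inequalities that are solvable in an ordered extension
field with the intermediate value property are solvable over `ℝ`. -/
theorem exists_real_point {σ : Type} [Fintype σ] {K : Type} [Field K] [LinearOrder K]
    [IsStrictOrderedRing K] (hK : HasIVT K) (φ : MvPolynomial σ ℝ →+* K)
    (J : Finset (MvPolynomial σ ℝ)) (hJ : ∀ P ∈ J, 0 ≤ φ P) :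
    ∃ b : σ → ℝ, ∀ P ∈ J, 0 ≤ eval b P := by
  have key : ∀ s : Finset σ, ∃ (U : Type) (_ : Field U) (_ : LinearOrder U)
      (_ : IsStrictOrderedRing U) (G : Type) (_ : Field G) (_ : LinearOrder G)
      (_ : IsStrictOrderedRing G) (α : G →+* K) (β : G →+* U) (j : ℝ →+* G),
      HasIVT U ∧ StrictMono α ∧ StrictMono β ∧ (∀ d, RootsIn α d) ∧ α.comp j = φ.comp C ∧
      SpecializesToReal (β.comp j) ∧ ∀ i ∈ s, φ (X i) ∈ Set.range α := by
    intro s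
    induction s using Finset.induction_on with
    | empty =>
      obtain ⟨G, _, _, _, α, β, ι, h1, h2, h3, h4, h5⟩ := exists_common_closed_field hK
        hasIVT_real (φ.comp C) (RingHom.id ℝ) (fun x => real_map_pos_iff _ x)
      refine ⟨ℝ, inferInstance, inferInstance, inferInstance, G, inferInstance, inferInstance,
        inferInstance, α, β, ι, hasIVT_real, h1, h2, h3, h4, ?_, by simp⟩
      rw [h5]
      exact fun _ J w hw => ⟨w, hw⟩
    | insert i s _ ih =>
      obtain ⟨U, _, _, _, G, _, _, _, α, β, j, hU, hα, hβ, hr, hαj, hsp, hs⟩ := ih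
      obtain ⟨V, _, _, _, e, x', hV, hsp', hk⟩ :=
        exists_same_type_ultrapower hK hU hα hβ hr hsp (φ (X i))
      obtain ⟨H, _, _, _, α', β', ι, h1, h2, h3, h4, h5⟩ := exists_common_closed_field hK
        hV (Polynomial.eval₂RingHom α (φ (X i))) (Polynomial.eval₂RingHom (e.comp β) x') hk
      have h6 : ∀ x, α' (ι x) = Polynomial.eval₂ α (φ (X i)) x := fun x =>
        congrArg (fun f => f x) h4
      have h7 : ∀ x, β' (ι x) = Polynomial.eval₂ (e.comp β) x' x := fun x =>
        congrArg (fun f => f x) h5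
      refine ⟨V, inferInstance, inferInstance, inferInstance, H, inferInstance, inferInstance,
        inferInstance, α', β', (ι.comp Polynomial.C).comp j, hV, h1, h2, h3, ?_, ?_, ?_⟩
      · rw [← hαj]
        ext x
        simp [h6]
      · have h8 : β'.comp ((ι.comp Polynomial.C).comp j) = e.comp (β.comp j) := by
          ext x
          simp [h7]
        rw [h8]
        exact hsp'
      · intro i' hi'
        rcases Finset.mem_insert.1 hi' with rfl | hi'
        · exact ⟨ι Polynomial.X, by simp [h6]⟩
        · obtain ⟨g, hg⟩ := hs i' hi'
          exact ⟨ι (Polynomial.C g), by simp [h6, hg]⟩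
  obtain ⟨U, _, _, _, G, _, _, _, α, β, j, hU, hα, hβ, hr, hαj, hsp, hs⟩ := key Finset.univ
  choose g hg using fun i => hs i (Finset.mem_univ i)
  refine hsp σ J (fun i => β (g i)) fun P hP => ?_
  have e1 : α.comp (eval₂Hom j g) = φ := by
    refine MvPolynomial.ringHom_ext (fun r => ?_) (fun i => by simp [hg])
    simpa using congrArg (fun f => f r) hαj
  have e2 : β (eval₂Hom j g P) = eval₂ (β.comp j) (fun i => β (g i)) P := by
    rw [coe_eval₂Hom, eval₂_comp_left]
    rfl
  rw [← e2]
  have h1 : 0 ≤ α (eval₂Hom j g P) := by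
    have := hJ P hP
    rwa [← e1] at this
  have h2 : 0 ≤ eval₂Hom j g P := by
    rw [← not_lt, neg_map_iff hα] at h1
    exact not_lt.1 h1
  rw [← not_lt, neg_map_iff hβ]
  exact not_lt.2 h2

/-! ### Quadratic modules -/

/-- A (not necessarily proper) quadratic module of a commutative ring. -/
structure IsQuadraticModule {A : Type*} [CommRing A] (M : Set A) : Prop where
  add : ∀ {a b}, a ∈ M → b ∈ M → a + b ∈ M
  one : (1 : A) ∈ M
  sq_mul : ∀ (a) {b}, b ∈ M → a ^ 2 * b ∈ M

namespace IsQuadraticModule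

section

variable {A : Type*} [CommRing A] {M : Set A}

lemma sq (h : IsQuadraticModule M) (a : A) : a ^ 2 ∈ M := by simpa using h.sq_mul a h.one

lemma zero (h : IsQuadraticModule M) : (0 : A) ∈ M := by simpa using h.sq 0

lemma sum (h : IsQuadraticModule M) {ι : Type*} (s : Finset ι) {f : ι → A}
    (hf : ∀ i ∈ s, f i ∈ M) : ∑ i ∈ s, f i ∈ M :=
  Finset.sum_induction f (· ∈ M) (fun _ _ => h.add) h.zero hf

lemma sumSq_mul (h : IsQuadraticModule M) {a b : A} (ha : IsSumSq a) (hb : b ∈ M) :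
    a * b ∈ M := by
  induction ha with
  | zero => simpa using h.zero
  | sq_add c _ ih =>
    rw [add_mul, ← _root_.sq]
    exact h.add (h.sq_mul c hb) ih

lemma sumSq (h : IsQuadraticModule M) {a : A} (ha : IsSumSq a) : a ∈ M := by
  simpa using h.sumSq_mul ha h.one

end

variable {A : Type*} [CommRing A] [Algebra ℝ A] {M : Set A}

lemma algebraMap_mul (h : IsQuadraticModule M) {r : ℝ} (hr : 0 ≤ r) {a : A} (ha : a ∈ M) :
    algebraMap ℝ A r * a ∈ M := by
  rw [← Real.sq_sqrt hr, map_pow]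
  exact h.sq_mul _ ha

lemma algebraMap_mem (h : IsQuadraticModule M) {r : ℝ} (hr : 0 ≤ r) : algebraMap ℝ A r ∈ M := by
  simpa using h.algebraMap_mul hr h.one

lemma of_algebraMap_mul (h : IsQuadraticModule M) {r : ℝ} (hr : 0 < r) {a : A}
    (ha : algebraMap ℝ A r * a ∈ M) : a ∈ M := by
  have := h.algebraMap_mul (inv_pos.2 hr).le ha
  rwa [← mul_assoc, ← map_mul, inv_mul_cancel₀ hr.ne', map_one, one_mul] at this

lemma sub_sq_mem (h : IsQuadraticModule M) {r : ℝ} (hr : 0 < r) {a : A}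
    (h1 : algebraMap ℝ A r - a ∈ M) (h2 : algebraMap ℝ A r + a ∈ M) :
    algebraMap ℝ A (r ^ 2) - a ^ 2 ∈ M := by
  refine h.of_algebraMap_mul (r := 2 * r) (by linarith) ?_
  convert h.add (h.sq_mul (algebraMap ℝ A r - a) h2) (h.sq_mul (algebraMap ℝ A r + a) h1) using 1
  simp only [map_mul, map_pow, map_ofNat]
  ring

/-- The subalgebra of elements that are bounded with respect to a quadratic module. -/
def bounded (h : IsQuadraticModule M) : Subalgebra ℝ A where
  carrier := {a | ∃ r : ℝ, 0 < r ∧ algebraMap ℝ A r - a ∈ M ∧ algebraMap ℝ A r + a ∈ M}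
  algebraMap_mem' r := by
    refine ⟨|r| + 1, by positivity, ?_, ?_⟩
    · rw [← map_sub]
      exact h.algebraMap_mem (by linarith [le_abs_self r])
    · rw [← map_add]
      exact h.algebraMap_mem (by linarith [neg_abs_le r])
  add_mem' := by
    rintro a b ⟨r, hr, h1, h2⟩ ⟨r', hr', h1', h2'⟩
    refine ⟨r + r', by linarith, ?_, ?_⟩
    · convert h.add h1 h1' using 1
      rw [map_add]; ring
    · convert h.add h2 h2' using 1
      rw [map_add]; ring
  mul_mem' := by
    rintro a b ⟨r, hr, h1, h2⟩ ⟨r', hr', h1', h2'⟩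
    have e1 : algebraMap ℝ A ((r + r') ^ 2) - (a + b) ^ 2 ∈ M := by
      refine h.sub_sq_mem (by linarith) ?_ ?_
      · convert h.add h1 h1' using 1
        rw [map_add]; ring
      · convert h.add h2 h2' using 1
        rw [map_add]; ring
    have e2 : algebraMap ℝ A ((r + r') ^ 2) - (a - b) ^ 2 ∈ M := by
      refine h.sub_sq_mem (by linarith) ?_ ?_
      · convert h.add h1 h2' using 1
        rw [map_add]; ring
      · convert h.add h2 h1' using 1
        rw [map_add]; ring
    refine ⟨(r + r') ^ 2, by positivity, ?_, ?_⟩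
    · refine h.of_algebraMap_mul (r := 4) (by norm_num) ?_
      convert h.add (h.add e1 (h.sq (a - b)))
        (h.algebraMap_mem (r := 3 * (r + r') ^ 2) (by positivity)) using 1
      simp only [map_mul, map_ofNat]
      ring
    · refine h.of_algebraMap_mul (r := 4) (by norm_num) ?_
      convert h.add (h.add e2 (h.sq (a + b)))
        (h.algebraMap_mem (r := 3 * (r + r') ^ 2) (by positivity)) using 1
      simp only [map_mul, map_ofNat]
      ring

/-- The archimedean property of a quadratic module. -/
def Archimedean (M : Set A) : Prop := ∀ a : A, ∃ r : ℝ, 0 < r ∧ algebraMap ℝ A r - a ∈ M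

lemma mem_bounded_of_sub_sq (h : IsQuadraticModule M) {r : ℝ} (hr : 0 ≤ r) {a : A}
    (ha : algebraMap ℝ A r - a ^ 2 ∈ M) : a ∈ h.bounded := by
  refine ⟨r + 1, by linarith, ?_, ?_⟩
  · refine h.of_algebraMap_mul (r := 2) (by norm_num) ?_
    convert h.add (h.add ha (h.sq (a - 1))) (h.algebraMap_mem (r := r + 1) (by linarith)) using 1
    simp only [map_add, map_ofNat, map_one]
    ring
  · refine h.of_algebraMap_mul (r := 2) (by norm_num) ?_
    convert h.add (h.add ha (h.sq (a + 1))) (h.algebraMap_mem (r := r + 1) (by linarith)) using 1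
    simp only [map_add, map_ofNat, map_one]
    ring

lemma archimedean_of_ball {σ : Type*} [Fintype σ] {M : Set (MvPolynomial σ ℝ)}
    (h : IsQuadraticModule M) {r : ℝ} (hr : 0 ≤ r) (hM : C r - ∑ i, X i ^ 2 ∈ M) :
    Archimedean M := by
  have hX : ∀ i, X i ∈ h.bounded := by
    intro i
    refine h.mem_bounded_of_sub_sq hr ?_
    convert h.add hM (h.sum (univ.erase i) fun j _ => h.sq (X j)) using 1
    rw [← Finset.add_sum_erase _ _ (mem_univ i), algebraMap_eq]
    ring
  have htop : h.bounded = ⊤ := by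
    rw [eq_top_iff, ← adjoin_range_X, Algebra.adjoin_le_iff]
    rintro _ ⟨i, rfl⟩
    exact hX i
  intro a
  obtain ⟨r, hr, h1, -⟩ : a ∈ h.bounded := htop ▸ Algebra.mem_top
  exact ⟨r, hr, h1⟩

end IsQuadraticModule

/-- The set `T + a T`. -/
def adjoinElem {A : Type*} [CommRing A] (T : Set A) (a : A) : Set A :=
  {z | ∃ x ∈ T, ∃ y ∈ T, z = x + a * y}

section adjoinElem

variable {A : Type*} [CommRing A] {T : Set A}

lemma IsQuadraticModule.adjoinElem (h : IsQuadraticModule T) (a : A) :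
    IsQuadraticModule (adjoinElem T a) where
  add := by
    rintro _ _ ⟨x, hx, y, hy, rfl⟩ ⟨x', hx', y', hy', rfl⟩
    exact ⟨x + x', h.add hx hx', y + y', h.add hy hy', by ring⟩
  one := ⟨1, h.one, 0, h.zero, by ring⟩
  sq_mul := by
    rintro b _ ⟨x, hx, y, hy, rfl⟩
    exact ⟨b ^ 2 * x, h.sq_mul b hx, b ^ 2 * y, h.sq_mul b hy, by ring⟩

lemma mul_mem_adjoinElem (h : IsQuadraticModule T) (hm : ∀ x ∈ T, ∀ y ∈ T, x * y ∈ T) (a : A) :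
    ∀ x ∈ adjoinElem T a, ∀ y ∈ adjoinElem T a, x * y ∈ adjoinElem T a := by
  rintro _ ⟨x, hx, y, hy, rfl⟩ _ ⟨x', hx', y', hy', rfl⟩
  exact ⟨x * x' + a ^ 2 * (y * y'), h.add (hm _ hx _ hx') (h.sq_mul a (hm _ hy _ hy')),
      x * y' + y * x', h.add (hm _ hx _ hy') (hm _ hy _ hx'), by ring⟩

lemma subset_adjoinElem (h : IsQuadraticModule T) (a : A) : T ⊆ adjoinElem T a :=
  fun x hx => ⟨x, hx, 0, h.zero, by ring⟩

lemma self_mem_adjoinElem (h : IsQuadraticModule T) (a : A) : a ∈ adjoinElem T a :=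
  ⟨0, h.zero, 1, h.one, by ring⟩

end adjoinElem

lemma isQuadraticModule_sumSq (A : Type*) [CommRing A] :
    IsQuadraticModule {a : A | IsSumSq a} where
  add := IsSumSq.add
  one := IsSumSq.one
  sq_mul a _ hb := by
    rw [sq]
    exact (IsSumSq.mul_self a).mul hb

/-- A preordering of a real polynomial ring without real points is improper. -/
lemma neg_one_mem_of_no_point {σ : Type} [Fintype σ] {T : Set (MvPolynomial σ ℝ)}
    (h : IsQuadraticModule T) (hm : ∀ x ∈ T, ∀ y ∈ T, x * y ∈ T)
    (J : Finset (MvPolynomial σ ℝ)) (hJ : ∀ P ∈ J, P ∈ T)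
    (hno : ∀ b : σ → ℝ, ∃ P ∈ J, eval b P < 0) : (-1 : MvPolynomial σ ℝ) ∈ T := by
  by_contra hneg
  have hT : IsPreordering T := ⟨h.add, fun hx hy => hm _ hx _ hy, h.sq, hneg⟩
  obtain ⟨K, _, _, φ, _, hK, hφ⟩ := hT.exists_hasIVT
  obtain ⟨b, hb⟩ := exists_real_point hK φ J fun P hP => hφ P (hJ P hP)
  obtain ⟨P, hP, hlt⟩ := hno b
  exact absurd (hb P hP) (not_le.2 hlt)

open IsQuadraticModule in
/-- **Wörmann's theorem**: a quadratic module containing a polynomial whose nonnegativity set is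
bounded is archimedean. -/
theorem IsQuadraticModule.archimedean_of_bounded {σ : Type} [Fintype σ]
    {M : Set (MvPolynomial σ ℝ)} (hM : IsQuadraticModule M) {p : MvPolynomial σ ℝ} (hp : p ∈ M)
    (hb : Bornology.IsBounded {y : σ → ℝ | 0 ≤ eval y p}) : Archimedean M := by
  have hS := isQuadraticModule_sumSq (MvPolynomial σ ℝ)
  have hSm : ∀ x ∈ {a : MvPolynomial σ ℝ | IsSumSq a}, ∀ y ∈ {a : MvPolynomial σ ℝ | IsSumSq a},
      x * y ∈ {a : MvPolynomial σ ℝ | IsSumSq a} := fun x hx y hy => IsSumSq.mul hx hy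
  set T := _root_.adjoinElem {a : MvPolynomial σ ℝ | IsSumSq a} p with hTdef
  have hT : IsQuadraticModule T := hS.adjoinElem p
  have hTm : ∀ x ∈ T, ∀ y ∈ T, x * y ∈ T := mul_mem_adjoinElem hS hSm p
  have hTM : T ⊆ M := by
    rintro _ ⟨x, hx, y, hy, rfl⟩
    rw [mul_comm]
    exact hM.add (hM.sumSq hx) (hM.sumSq_mul hy hp)
  obtain ⟨R, hR0, hR⟩ : ∃ R : ℝ, 0 ≤ R ∧ ∀ y : σ → ℝ, 0 ≤ eval y p → ∑ i, y i ^ 2 < R := by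
    obtain ⟨r, hr⟩ := hb.exists_norm_le
    refine ⟨∑ _i : σ, r ^ 2 + 1, by positivity, fun y hy => ?_⟩
    refine lt_of_le_of_lt (Finset.sum_le_sum fun i _ => ?_) (lt_add_one _)
    exact sq_le_sq' (by linarith [(abs_le.1 ((norm_le_pi_norm y i).trans (hr y hy))).1])
      (abs_le.1 ((norm_le_pi_norm y i).trans (hr y hy))).2
  set S : MvPolynomial σ ℝ := ∑ i, X i ^ 2 with hSdef
  have hST : S ∈ T := hT.sum _ fun i _ => hT.sq _
  have hneg : (-1 : MvPolynomial σ ℝ) ∈ _root_.adjoinElem T (S - C R) := by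
    refine neg_one_mem_of_no_point (hT.adjoinElem _) (mul_mem_adjoinElem hT hTm _)
      {p, S - C R} ?_ ?_
    · intro P hP
      rcases Finset.mem_insert.1 hP with rfl | hP
      · exact subset_adjoinElem hT _ (self_mem_adjoinElem hS _)
      · rw [Finset.mem_singleton.1 hP]
        exact self_mem_adjoinElem hT _
    · intro b
      by_cases hbp : 0 ≤ eval b p
      · exact ⟨S - C R, by simp, by simpa [hSdef] using hR b hbp⟩
      · exact ⟨p, by simp, not_le.1 hbp⟩
  obtain ⟨t, ht, t', ht', e⟩ := hneg
  set g : MvPolynomial σ ℝ := C R - S with hg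
  have hgt : g * (1 + t) ∈ T := by
    have : g * (1 + t) = g ^ 2 * t' := by
      have : 1 + t = g * t' := by linear_combination -e
      rw [this]; ring
    rw [this]
    exact hT.sq_mul g ht'
  have hT' := hT.adjoinElem g
  obtain ⟨r, hr, x, hx, y, hy, e'⟩ := hT'.archimedean_of_ball hR0 (self_mem_adjoinElem hT _) t
  rw [algebraMap_eq] at e'
  have h1 : (1 + t) * (C r - t) ∈ T := by
    have : (1 + t) * (C r - t) = (1 + t) * x + g * (1 + t) * y := by rw [e']; ring
    rw [this]
    exact hT.add (hTm _ (hT.add hT.one ht) _ hx) (hTm _ hgt _ hy)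
  have h2 : C (r + r ^ 2 / 4) - t ∈ T := by
    convert hT.add h1 (hT.sq (C (r / 2) - t)) using 1
    have e1 : (C r : MvPolynomial σ ℝ) = 2 * C (r / 2) := by
      rw [← map_ofNat C 2, ← C_mul]; congr 1; ring
    have e2 : (C (r + r ^ 2 / 4) : MvPolynomial σ ℝ) = C r + C (r / 2) ^ 2 := by
      rw [← C_pow, ← C_add]; congr 1; ring
    rw [e2, e1]
    ring
  refine hM.archimedean_of_ball (r := R + R * (r + r ^ 2 / 4)) (by positivity) (hTM ?_)
  convert hT.add (hT.add hgt (hTm _ hST _ ht)) (hT.algebraMap_mul hR0 h2) using 1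
  rw [hg, algebraMap_eq, C_add, C_mul]
  ring

/-! ### The Positivstellensatz for archimedean quadratic modules -/

/-- The quadratic module generated by `M` and `a`. -/
def adjoinSumSq {A : Type*} [CommRing A] (M : Set A) (a : A) : Set A :=
  {z | ∃ x ∈ M, ∃ y, IsSumSq y ∧ z = x + y * a}

namespace IsQuadraticModule

section

variable {A : Type*} [CommRing A] {M : Set A}

lemma adjoinSumSq (h : IsQuadraticModule M) (a : A) : IsQuadraticModule (adjoinSumSq M a) where
  add := by
    rintro _ _ ⟨x, hx, y, hy, rfl⟩ ⟨x', hx', y', hy', rfl⟩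
    exact ⟨x + x', h.add hx hx', y + y', hy.add hy', by ring⟩
  one := ⟨1, h.one, 0, .zero, by ring⟩
  sq_mul := by
    rintro b _ ⟨x, hx, y, hy, rfl⟩
    exact ⟨b ^ 2 * x, h.sq_mul b hx, b * b * y, (IsSumSq.mul_self b).mul hy, by ring⟩

lemma subset_adjoinSumSq (a : A) : M ⊆ _root_.adjoinSumSq M a :=
  fun x hx => ⟨x, hx, 0, .zero, by ring⟩

lemma self_mem_adjoinSumSq (h : IsQuadraticModule M) (a : A) : a ∈ _root_.adjoinSumSq M a :=
  ⟨0, h.zero, 1, .one, by ring⟩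

end

variable {A : Type*} [CommRing A] [Algebra ℝ A] {M : Set A}

lemma mul_mem_of_mem_of_neg_mem (h : IsQuadraticModule M) {x : A} (hx : x ∈ M) (hx' : -x ∈ M)
    (a : A) : a * x ∈ M := by
  refine h.of_algebraMap_mul (r := 4) (by norm_num) ?_
  convert h.add (h.sq_mul (a + 1) hx) (h.sq_mul (a - 1) hx') using 1
  rw [map_ofNat]
  ring

lemma exists_maximal (h : IsQuadraticModule M) (hneg : (-1 : A) ∉ M) :
    ∃ P : Set A, IsQuadraticModule P ∧ M ⊆ P ∧ (-1 : A) ∉ P ∧ ∀ a, a ∈ P ∨ -a ∈ P := by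
  obtain ⟨P, hMP, hP⟩ := zorn_subset_nonempty {T : Set A | IsQuadraticModule T ∧ (-1 : A) ∉ T} (by
    intro c hc hch hne
    refine ⟨⋃₀ c, ⟨⟨?_, ?_, ?_⟩, ?_⟩, fun s hs => Set.subset_sUnion_of_mem hs⟩
    · rintro a b ⟨S, hS, ha⟩ ⟨S', hS', hb⟩
      rcases hch.total hS hS' with h | h
      · exact ⟨S', hS', (hc hS').1.add (h ha) hb⟩
      · exact ⟨S, hS, (hc hS).1.add ha (h hb)⟩
    · obtain ⟨S, hS⟩ := hne
      exact ⟨S, hS, (hc hS).1.one⟩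
    · rintro a b ⟨S, hS, hb⟩
      exact ⟨S, hS, (hc hS).1.sq_mul a hb⟩
    · rintro ⟨S, hS, hn⟩
      exact (hc hS).2 hn) M ⟨h, hneg⟩
  obtain ⟨hQ, hPneg⟩ := hP.prop
  refine ⟨P, hQ, hMP, hPneg, fun a => ?_⟩
  have key : ∀ a, a ∉ P → (-1 : A) ∈ _root_.adjoinSumSq P a := by
    intro a ha
    by_contra hn
    exact ha (hP.le_of_ge ⟨hQ.adjoinSumSq a, hn⟩ (subset_adjoinSumSq a)
      (hQ.self_mem_adjoinSumSq a))
  by_contra! hna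
  obtain ⟨m₁, hm₁, σ₁, hσ₁, e₁⟩ := key a hna.1
  obtain ⟨m₂, hm₂, σ₂, hσ₂, e₂⟩ := key (-a) hna.2
  have h1 : -σ₁ ∈ P := by
    have : -σ₁ = σ₂ + (σ₂ * m₁ + σ₁ * m₂) := by linear_combination σ₂ * e₁ + σ₁ * e₂
    rw [this]
    exact hQ.add (hQ.sumSq hσ₂) (hQ.add (hQ.sumSq_mul hσ₂ hm₁) (hQ.sumSq_mul hσ₁ hm₂))
  refine hPneg ?_
  rw [e₁, mul_comm]
  exact hQ.add hm₁ (hQ.mul_mem_of_mem_of_neg_mem (hQ.sumSq hσ₁) h1 a)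

lemma nonneg_of_algebraMap_mem (h : IsQuadraticModule M) (hneg : (-1 : A) ∉ M) {r : ℝ}
    (hr : algebraMap ℝ A r ∈ M) : 0 ≤ r := by
  by_contra! hlt
  refine hneg (h.of_algebraMap_mul (r := -r) (by linarith) ?_)
  simpa using hr

/-- An archimedean quadratic module not containing `-1` is nonnegative at some real point. -/
lemma exists_algHom (h : IsQuadraticModule M) (harch : Archimedean M) (hneg : (-1 : A) ∉ M) :
    ∃ φ : A →ₐ[ℝ] ℝ, ∀ a ∈ M, 0 ≤ φ a := by
  obtain ⟨P, hP, hMP, hPneg, htot⟩ := h.exists_maximal hneg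
  let Z : A → Prop := fun z => ∀ ε : ℝ, 0 < ε → algebraMap ℝ A ε - z ∈ P ∧ algebraMap ℝ A ε + z ∈ P
  have Zadd : ∀ {a b}, Z a → Z b → Z (a + b) := by
    intro a b ha hb ε hε
    have h1 := ha (ε / 2) (by linarith)
    have h2 := hb (ε / 2) (by linarith)
    have e : algebraMap ℝ A ε = algebraMap ℝ A (ε / 2) + algebraMap ℝ A (ε / 2) := by
      rw [← map_add, add_halves]
    constructor
    · convert hP.add h1.1 h2.1 using 1
      rw [e]; ring
    · convert hP.add h1.2 h2.2 using 1
      rw [e]; ring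
  have Zneg : ∀ {a}, Z a → Z (-a) := by
    intro a ha ε hε
    rw [sub_neg_eq_add, ← sub_eq_add_neg]
    exact (ha ε hε).symm
  have Zmul_nonneg : ∀ {r : ℝ} {a}, 0 ≤ r → Z a → Z (algebraMap ℝ A r * a) := by
    intro r a hr ha ε hε
    have h1 := ha (ε / (r + 1)) (by positivity)
    have e : algebraMap ℝ A ε = algebraMap ℝ A r * algebraMap ℝ A (ε / (r + 1)) +
        algebraMap ℝ A (ε / (r + 1)) := by
      rw [← map_mul, ← map_add]
      congr 1
      field_simp
    have h3 := hP.algebraMap_mem (r := ε / (r + 1)) (by positivity)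
    constructor
    · convert hP.add (hP.algebraMap_mul hr h1.1) h3 using 1
      rw [e]; ring
    · convert hP.add (hP.algebraMap_mul hr h1.2) h3 using 1
      rw [e]; ring
  have Zmul : ∀ {r : ℝ} {a}, Z a → Z (algebraMap ℝ A r * a) := by
    intro r a ha
    rcases le_total 0 r with hr | hr
    · exact Zmul_nonneg hr ha
    · have := Zneg (Zmul_nonneg (neg_nonneg.2 hr) ha)
      rwa [map_neg, neg_mul, neg_neg] at this
  have Zsq : ∀ {a}, Z a → Z (a ^ 2) := by
    intro a ha ε hε
    have h1 := ha (√ε) (Real.sqrt_pos.2 hε)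
    have h2 := hP.sub_sq_mem (Real.sqrt_pos.2 hε) h1.1 h1.2
    rw [Real.sq_sqrt hε.le] at h2
    exact ⟨h2, hP.add (hP.algebraMap_mem hε.le) (hP.sq a)⟩
  have Zconst : ∀ {r : ℝ}, Z (algebraMap ℝ A r) → r = 0 := by
    intro r hr
    have h1 : ∀ ε : ℝ, 0 < ε → |r| ≤ 0 + ε := by
      intro ε hε
      have h1 := hr ε hε
      rw [← map_sub, ← map_add] at h1
      have h2 := hP.nonneg_of_algebraMap_mem hPneg h1.1
      have h3 := hP.nonneg_of_algebraMap_mem hPneg h1.2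
      rw [abs_le]
      constructor <;> linarith
    exact abs_nonpos_iff.1 (le_of_forall_pos_le_add h1)
  have hex : ∀ a, ∃ r : ℝ, Z (a - algebraMap ℝ A r) := by
    intro a
    obtain ⟨r₁, -, hr₁⟩ := harch a
    obtain ⟨r₂, -, hr₂⟩ := harch (-a)
    set S : Set ℝ := {r | algebraMap ℝ A r - a ∈ P} with hS
    have hne : S.Nonempty := ⟨r₁, hMP hr₁⟩
    have hbd : BddBelow S := by
      refine ⟨-r₂, fun r hr => ?_⟩
      have := hP.add hr (hMP hr₂)
      have e : algebraMap ℝ A r - a + (algebraMap ℝ A r₂ - -a) = algebraMap ℝ A (r + r₂) := by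
        rw [map_add]; ring
      rw [e] at this
      linarith [hP.nonneg_of_algebraMap_mem hPneg this]
    refine ⟨sInf S, fun ε hε => ⟨?_, ?_⟩⟩
    · obtain ⟨r, hr, hlt⟩ := exists_lt_of_csInf_lt hne (lt_add_of_pos_right (sInf S) hε)
      convert hP.add hr (hP.algebraMap_mem (r := sInf S + ε - r) (by linarith)) using 1
      simp only [map_add, map_sub]
      ring
    · rcases htot (algebraMap ℝ A (sInf S - ε) - a) with h1 | h1
      · linarith [csInf_le hbd h1]
      · convert h1 using 1
        simp only [map_sub]
        ring
  choose α hα using hex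
  have huniq : ∀ {a} {r : ℝ}, Z (a - algebraMap ℝ A r) → α a = r := by
    intro a r hr
    have := Zadd (Zneg (hα a)) hr
    have e : -(a - algebraMap ℝ A (α a)) + (a - algebraMap ℝ A r) =
        algebraMap ℝ A (α a - r) := by rw [map_sub]; ring
    rw [e] at this
    linarith [Zconst this]
  have Z0 : Z 0 := fun ε hε => by simpa using hP.algebraMap_mem hε.le
  have αconst : ∀ r, α (algebraMap ℝ A r) = r := fun r => huniq (by simpa using Z0)
  have αadd : ∀ a b, α (a + b) = α a + α b := by
    intro a b
    refine huniq ?_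
    convert Zadd (hα a) (hα b) using 1
    rw [map_add]; ring
  have αmulc : ∀ (r : ℝ) a, α (algebraMap ℝ A r * a) = r * α a := by
    intro r a
    refine huniq ?_
    convert Zmul (r := r) (hα a) using 1
    rw [map_mul]; ring
  have αsq : ∀ a, α (a ^ 2) = α a ^ 2 := by
    intro a
    refine huniq ?_
    convert Zadd (Zmul (r := 2 * α a) (hα a)) (Zsq (hα a)) using 1
    simp only [map_mul, map_pow, map_ofNat]
    ring
  have αmul : ∀ a b, α (a * b) = α a * α b := by
    intro a b
    have h1 := αsq (a + b)
    have e : (a + b) ^ 2 = a ^ 2 + b ^ 2 + algebraMap ℝ A 2 * (a * b) := by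
      rw [map_ofNat]; ring
    rw [e, αadd, αadd, αmulc, αsq, αsq, αadd] at h1
    linarith
  have α0 : α 0 = 0 := by simpa using αconst 0
  have α1 : α 1 = 1 := by simpa using αconst 1
  refine ⟨⟨⟨⟨⟨α, α1⟩, αmul⟩, α0, αadd⟩, αconst⟩, ?_⟩
  intro a ha
  change 0 ≤ α a
  refine le_of_forall_pos_le_add fun ε hε => ?_
  have h1 := hP.add (hα a ε hε).1 (hMP ha)
  have e : algebraMap ℝ A ε - (a - algebraMap ℝ A (α a)) + a = algebraMap ℝ A (α a + ε) := by
    rw [map_add]; ring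
  rw [e] at h1
  exact hP.nonneg_of_algebraMap_mem hPneg h1

/-- **Jacobi's representation theorem** for archimedean quadratic modules. -/
theorem mem_of_forall_algHom_pos (h : IsQuadraticModule M) (harch : Archimedean M) {f : A}
    (hf : ∀ φ : A →ₐ[ℝ] ℝ, (∀ a ∈ M, 0 ≤ φ a) → 0 < φ f) : f ∈ M := by
  obtain ⟨m, hm, p, hp, e⟩ : (-1 : A) ∈ _root_.adjoinSumSq M (-f) := by
    by_contra hneg
    obtain ⟨φ, hφ⟩ := (h.adjoinSumSq (-f)).exists_algHom (fun a => by
      obtain ⟨r, hr, hr'⟩ := harch a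
      exact ⟨r, hr, subset_adjoinSumSq _ hr'⟩) hneg
    have h1 := hf φ fun a ha => hφ a (subset_adjoinSumSq _ ha)
    have h2 := hφ _ (h.self_mem_adjoinSumSq (-f))
    rw [map_neg] at h2
    linarith
  have hpf : p * f - 1 ∈ M := by
    have : p * f - 1 = m := by linear_combination e
    rwa [this]
  obtain ⟨r₁, hr₁, h₁⟩ := harch p
  obtain ⟨r₂, hr₂, h₂⟩ := harch (p ^ 2 * f)
  obtain ⟨r₃, hr₃, h₃⟩ := harch (-f)
  set k : ℝ := r₁ + r₂ + 1 with hk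
  have hk0 : 0 < k := by positivity
  set κ := algebraMap ℝ A k with hκ
  have h4 : 2 * κ - p ∈ M := by
    convert h.add h₁ (h.algebraMap_mem (r := 2 * k - r₁) (by linarith)) using 1
    simp only [map_sub, map_mul, map_ofNat, hκ]
    ring
  have h5 : 2 * κ - 1 - p ^ 2 * f ∈ M := by
    convert h.add h₂ (h.algebraMap_mem (r := 2 * k - 1 - r₂) (by linarith)) using 1
    simp only [map_sub, map_mul, map_ofNat, map_one, hκ]
    ring
  have h6 : p * (2 * κ - p) ∈ M := by
    refine h.of_algebraMap_mul (r := 2 * k) (by linarith) ?_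
    convert h.add (h.sq_mul p h4) (h.sq_mul (2 * κ - p) (h.sumSq hp)) using 1
    simp only [map_mul, map_ofNat, ← hκ]
    ring
  have step : ∀ r : ℝ, 0 ≤ r → f + algebraMap ℝ A r ∈ M →
      f + algebraMap ℝ A (r - (k ^ 2)⁻¹) ∈ M := by
    intro r hr hfr
    refine h.of_algebraMap_mul (r := k ^ 2) (by positivity) ?_
    have e1 : algebraMap ℝ A (k ^ 2) * (f + algebraMap ℝ A (r - (k ^ 2)⁻¹)) =
        κ ^ 2 * (f + algebraMap ℝ A r) - 1 := by
      rw [mul_add, ← map_mul, mul_sub, mul_inv_cancel₀ (by positivity), map_sub, map_mul,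
        map_pow, map_one]
      ring
    rw [e1]
    convert h.add (h.add (h.add (h.sq_mul (κ - p) hfr)
      (h.algebraMap_mul (r := 2 * k) (by linarith) hpf)) (h.algebraMap_mul hr h6)) h5 using 1
    simp only [map_mul, map_ofNat, ← hκ]
    ring
  have iter : ∀ N : ℕ, ∀ r : ℝ, r ≤ N * (k ^ 2)⁻¹ → f + algebraMap ℝ A r ∈ M → f ∈ M := by
    have base : ∀ r : ℝ, r ≤ 0 → f + algebraMap ℝ A r ∈ M → f ∈ M := by
      intro r hr hfr
      convert h.add hfr (h.algebraMap_mem (r := -r) (by linarith)) using 1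
      rw [map_neg]; ring
    intro N
    induction N with
    | zero => exact fun r hr => base r (by simpa using hr)
    | succ N ih =>
      intro r hr hfr
      rcases le_total r 0 with h0 | h0
      · exact base r h0 hfr
      · refine ih _ ?_ (step r h0 hfr)
        push_cast at hr
        linarith
  obtain ⟨N, hN⟩ := exists_nat_ge (r₃ * k ^ 2)
  refine iter N r₃ ?_ ?_
  · rw [← div_eq_mul_inv, le_div_iff₀ (by positivity)]
    exact hN
  · convert h₃ using 1
    ring

/-- **Putinar's Positivstellensatz**. -/
theorem mem_of_eval_pos {σ : Type*} {M : Set (MvPolynomial σ ℝ)} (h : IsQuadraticModule M)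
    (harch : Archimedean M) {f : MvPolynomial σ ℝ}
    (hf : ∀ y : σ → ℝ, (∀ a ∈ M, 0 ≤ eval y a) → 0 < eval y f) : f ∈ M := by
  refine h.mem_of_forall_algHom_pos harch fun φ hφ => ?_
  have hφe : ∀ a, φ a = eval (fun i => φ (X i)) a := by
    intro a
    conv_lhs => rw [aeval_unique φ]
    rfl
  rw [hφe]
  exact hf _ fun a ha => hφe a ▸ hφ a ha

end IsQuadraticModule

/-! ### Splitting sparse positive polynomials -/

/-- The point `x` with the coordinates outside `J` set to zero. -/
def restrictTo {V : Type*} (J : Finset V) (x : V → ℝ) : V → ℝ := fun k => if k ∈ J then x k else 0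

section

variable {V : Type*}

lemma restrictTo_apply_of_mem {J : Finset V} {k : V} (hk : k ∈ J) (x : V → ℝ) :
    restrictTo J x k = x k := if_pos hk

lemma restrictTo_apply_of_notMem {J : Finset V} {k : V} (hk : k ∉ J) (x : V → ℝ) :
    restrictTo J x k = 0 := if_neg hk

lemma restrictTo_congr {J : Finset V} {x y : V → ℝ} (h : ∀ k ∈ J, x k = y k) :
    restrictTo J x = restrictTo J y := by
  ext k
  by_cases hk : k ∈ J
  · simp only [restrictTo_apply_of_mem hk, h k hk]
  · simp only [restrictTo_apply_of_notMem hk]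

lemma restrictTo_eq_self {J : Finset V} {x : V → ℝ} (h : ∀ k ∉ J, x k = 0) :
    restrictTo J x = x := by
  ext k
  by_cases hk : k ∈ J
  · rw [restrictTo_apply_of_mem hk]
  · rw [restrictTo_apply_of_notMem hk, h k hk]

lemma continuous_restrictTo (J : Finset V) : Continuous (restrictTo J) := by
  refine continuous_pi fun k => ?_
  by_cases hk : k ∈ J
  · simp only [restrictTo, if_pos hk]
    exact continuous_apply k
  · simp only [restrictTo, if_neg hk]
    exact continuous_const

lemma eval_congr_of_vars_subset {J : Finset V} {p : MvPolynomial V ℝ} (hp : p.vars ⊆ J)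
    {x y : V → ℝ} (h : ∀ k ∈ J, x k = y k) : eval x p = eval y p :=
  eval₂Hom_congr' rfl (fun k hk _ => h k (hp hk)) rfl

/-- Weierstrass approximation on compact subsets of a finite dimensional space. -/
lemma exists_mvPolynomial_near [Fintype V] (φ : C(V → ℝ, ℝ)) {B : Set (V → ℝ)}
    (hB : IsCompact B) {ε : ℝ} (hε : 0 < ε) :
    ∃ Q : MvPolynomial V ℝ, ∀ y ∈ B, |eval y Q - φ y| < ε := by
  let Φ : MvPolynomial V ℝ →ₐ[ℝ] C(V → ℝ, ℝ) := aeval fun k => ⟨fun y => y k, continuous_apply k⟩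
  have hΦ : ∀ Q y, Φ Q y = eval y Q := by
    intro Q y
    induction Q using MvPolynomial.induction_on with
    | C a => simp [Φ]
    | add p q hp hq => simp only [map_add, ContinuousMap.add_apply, hp, hq]
    | mul_X p k hp => simp only [map_mul, ContinuousMap.mul_apply, hp, eval_X]; simp [Φ]
  have hsep : Φ.range.SeparatesPoints := by
    intro x y hxy
    obtain ⟨k, hk⟩ := Function.ne_iff.1 hxy
    exact ⟨Φ (X k), ⟨Φ (X k), ⟨X k, rfl⟩, rfl⟩, by simpa [hΦ] using hk⟩
  obtain ⟨_, ⟨Q, rfl⟩, hQ⟩ :=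
    ContinuousMap.exists_mem_subalgebra_near_continuous_of_isCompact_of_separatesPoints hsep φ hB hε
  exact ⟨Q, fun y hy => by simpa [hΦ] using hQ y hy⟩

lemma exists_between_of_isCompact {A B : Set ℝ} (hA : IsCompact A) (hB : IsCompact B)
    (h : ∀ a ∈ A, ∀ b ∈ B, a < b) : ∃ c, (∀ a ∈ A, a < c) ∧ ∀ b ∈ B, c < b := by
  rcases A.eq_empty_or_nonempty with rfl | hA'
  · obtain ⟨c, hc⟩ := hB.bddBelow
    exact ⟨c - 1, by simp, fun b hb => by linarith [hc hb]⟩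
  · obtain ⟨a, ha, hmax⟩ := hA.exists_isGreatest hA'
    obtain ⟨b, hab, hb⟩ := hB.exists_forall_le' continuousOn_id (fun b hb => h a ha b hb)
    obtain ⟨c, hac, hcb⟩ := exists_between hab
    exact ⟨c, fun a' ha' => (hmax ha').trans_lt hac, fun b' hb' => hcb.trans_le (hb b' hb')⟩

/-- Two compact sets carrying continuous functions `G < f` over a common base can be separated by a
continuous function on the base. -/
lemma exists_continuous_separating [Fintype V] {E : (V → ℝ) → V → ℝ} (hE : Continuous E)
    {K W : Set (V → ℝ)} (hK : IsCompact K) (hW : IsCompact W) {f G : (V → ℝ) → ℝ}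
    (hf : Continuous f) (hG : Continuous G)
    (h : ∀ z ∈ K, ∀ w ∈ W, E z = E w → G w < f z) :
    ∃ φ : C(V → ℝ, ℝ), (∀ z ∈ K, φ (E z) < f z) ∧ ∀ w ∈ W, G w < φ (E w) := by
  obtain ⟨φ, hφ⟩ := exists_continuous_forall_mem_convex_of_local_const
    (t := fun y : V → ℝ => {r : ℝ | (∀ z ∈ K, E z = y → r < f z) ∧ ∀ w ∈ W, E w = y → G w < r})
    (fun y => by
      refine Set.OrdConnected.convex ⟨fun a ha b hb c hc =>
        ⟨fun z hz hzy => ?_, fun w hw hwy => ?_⟩⟩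
      · exact hc.2.trans_lt (hb.1 z hz hzy)
      · exact (ha.2 w hw hwy).trans_le hc.1)
    (fun y => by
      obtain ⟨c, h1, h2⟩ := exists_between_of_isCompact (A := G '' (W ∩ E ⁻¹' {y}))
        (B := f '' (K ∩ E ⁻¹' {y}))
        ((hW.inter_right (isClosed_singleton.preimage hE)).image hG)
        ((hK.inter_right (isClosed_singleton.preimage hE)).image hf) (by
          rintro _ ⟨w, ⟨hw, hwy⟩, rfl⟩ _ ⟨z, ⟨hz, hzy⟩, rfl⟩
          exact h z hz w hw (hzy.trans hwy.symm))
      refine ⟨c, ?_⟩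
      have e1 : ∀ᶠ y' in nhds y, y' ∉ E '' (K ∩ {z | f z ≤ c}) := by
        refine IsOpen.mem_nhds ((hK.inter_right
          (isClosed_le hf continuous_const)).image hE).isClosed.isOpen_compl ?_
        rintro ⟨z, ⟨hz, hzc⟩, hzy⟩
        exact absurd (h2 _ ⟨z, ⟨hz, hzy⟩, rfl⟩) (not_lt.2 hzc)
      have e2 : ∀ᶠ y' in nhds y, y' ∉ E '' (W ∩ {w | c ≤ G w}) := by
        refine IsOpen.mem_nhds ((hW.inter_right
          (isClosed_le continuous_const hG)).image hE).isClosed.isOpen_compl ?_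
        rintro ⟨w, ⟨hw, hwc⟩, hwy⟩
        exact absurd (h1 _ ⟨w, ⟨hw, hwy⟩, rfl⟩) (not_lt.2 hwc)
      filter_upwards [e1, e2] with y' h3 h4
      refine ⟨fun z hz hzy => ?_, fun w hw hwy => ?_⟩
      · by_contra! hn
        exact h3 ⟨z, ⟨hz, hn⟩, hzy⟩
      · by_contra! hn
        exact h4 ⟨w, ⟨hw, hn⟩, hwy⟩)
  exact ⟨φ, fun z hz => (hφ _).1 z hz rfl, fun w hw => (hφ _).2 w hw rfl⟩

lemma exists_polynomial_separating [Fintype V] (C : Finset V)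
    {K W : Set (V → ℝ)} (hK : IsCompact K) (hW : IsCompact W) {f G : (V → ℝ) → ℝ}
    (hf : Continuous f) (hG : Continuous G)
    (h : ∀ z ∈ K, ∀ w ∈ W, (∀ k ∈ C, z k = w k) → G w < f z) :
    ∃ q : MvPolynomial V ℝ, q.vars ⊆ C ∧ (∀ z ∈ K, eval z q < f z) ∧ ∀ w ∈ W, G w < eval w q := by
  have hE := continuous_restrictTo C
  obtain ⟨φ, h1, h2⟩ := exists_continuous_separating hE hK hW hf hG (by
    intro z hz w hw hzw
    refine h z hz w hw fun k hk => ?_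
    rw [← restrictTo_apply_of_mem hk z, hzw, restrictTo_apply_of_mem hk w])
  obtain ⟨δ₁, hδ₁, h1'⟩ := hK.exists_forall_le' (f := fun z => f z - φ (restrictTo C z))
    (by fun_prop) (a := 0) (fun z hz => sub_pos.2 (h1 z hz))
  obtain ⟨δ₂, hδ₂, h2'⟩ := hW.exists_forall_le' (f := fun w => φ (restrictTo C w) - G w)
    (by fun_prop) (a := 0) (fun w hw => sub_pos.2 (h2 w hw))
  obtain ⟨Q, hQ⟩ := exists_mvPolynomial_near φ ((hK.union hW).image hE) (lt_min hδ₁ hδ₂)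
  let τ : V → MvPolynomial V ℝ := fun k => if k ∈ C then X k else 0
  have hev : ∀ x, eval x (aeval τ Q) = eval (restrictTo C x) Q := by
    intro x
    rw [← coe_aeval_eq_eval, ← coe_aeval_eq_eval, RingHom.coe_coe, RingHom.coe_coe,
      ← AlgHom.comp_apply]
    congr 1
    ext k
    by_cases hk : k ∈ C <;> simp [τ, hk, restrictTo]
  have hvars : ∀ Q : MvPolynomial V ℝ, (aeval τ Q).vars ⊆ C := by
    intro Q
    have : aeval τ Q ∈ supported ℝ (C : Set V) := by
      induction Q using MvPolynomial.induction_on with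
      | C a =>
        rw [aeval_C]
        exact Subalgebra.algebraMap_mem _ a
      | add p q hp hq =>
        rw [map_add]
        exact add_mem hp hq
      | mul_X p k hp =>
        rw [map_mul, aeval_X]
        refine mul_mem hp ?_
        by_cases hk : k ∈ C
        · simp [τ, hk]
        · simp only [τ, hk, if_false]
          exact zero_mem _
    rw [mem_supported] at this
    exact_mod_cast this
  refine ⟨aeval τ Q, hvars Q, fun z hz => ?_, fun w hw => ?_⟩
  · have h3 := (abs_lt.1 (hQ _ ⟨z, .inl hz, rfl⟩)).2
    rw [hev]
    linarith [h1' z hz, min_le_left δ₁ δ₂]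
  · have h3 := (abs_lt.1 (hQ _ ⟨w, .inr hw, rfl⟩)).1
    rw [hev]
    linarith [h2' w hw, min_le_right δ₁ δ₂]


lemma isCompact_sparse [Fintype V] {ι : Type*} [Finite ι] (J : ι → Finset V)
    (K : ι → Set (V → ℝ)) (hK : ∀ i, IsCompact (K i)) :
    IsCompact {w : V → ℝ | (∀ k, (∀ i, k ∉ J i) → w k = 0) ∧ ∀ i, restrictTo (J i) w ∈ K i} := by
  refine Metric.isCompact_of_isClosed_isBounded ?_ ?_
  · rw [Set.ofPred_and, Set.ofPred_forall, Set.ofPred_forall]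
    refine IsClosed.inter (isClosed_iInter fun k => ?_) (isClosed_iInter fun i => ?_)
    · by_cases hk : ∀ i, k ∉ J i
      · simp only [hk, not_false_eq_true, implies_true, forall_const]
        exact isClosed_eq (continuous_apply k) continuous_const
      · simp only [hk, false_implies, Set.ofPred_true, isClosed_univ]
    · exact (hK i).isClosed.preimage (continuous_restrictTo _)
  · obtain ⟨R, hR0, hR⟩ := ((Bornology.isBounded_iUnion.2
      fun i => (hK i).isBounded).exists_pos_norm_le)
    refine isBounded_iff_forall_norm_le.2 ⟨R, fun w hw => ?_⟩
    refine (pi_norm_le_iff_of_nonneg hR0.le).2 fun k => ?_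
    by_cases hk : ∃ i, k ∈ J i
    · obtain ⟨i, hi⟩ := hk
      rw [← restrictTo_apply_of_mem hi w]
      exact (norm_le_pi_norm _ k).trans (hR _ (Set.mem_iUnion.2 ⟨i, hw.2 i⟩))
    · push Not at hk
      rw [hw.1 k hk, norm_zero]
      exact hR0.le

/-- Under the running intersection property, a sparse sum that is positive on a compact set with
the same sparsity pattern splits into summands that are positive on the respective projections. -/
theorem exists_sparse_pos_splitting [Fintype V] (s : ℕ) (J : Fin (s + 1) → Finset V)
    (K : Fin (s + 1) → Set (V → ℝ)) (f : Fin (s + 1) → MvPolynomial V ℝ)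
    (hrip : ∀ i, 0 < i → ∃ t < i, ∀ k ∈ J i, ∀ j < i, k ∈ J j → k ∈ J t)
    (hK : ∀ i, IsCompact (K i)) (hKJ : ∀ i, ∀ z ∈ K i, ∀ k ∉ J i, z k = 0)
    (hf : ∀ i, (f i).vars ⊆ J i)
    (hpos : ∀ x : V → ℝ, (∀ i, restrictTo (J i) x ∈ K i) → 0 < ∑ i, eval x (f i)) :
    ∃ f' : Fin (s + 1) → MvPolynomial V ℝ, (∀ i, (f' i).vars ⊆ J i) ∧ ∑ i, f' i = ∑ i, f i ∧
      ∀ i, ∀ z ∈ K i, 0 < eval z (f' i) := by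
  induction s with
  | zero =>
    have : Subsingleton (Fin (0 + 1)) := inferInstanceAs (Subsingleton (Fin 1))
    refine ⟨f, hf, rfl, fun i z hz => ?_⟩
    have := hpos z fun j => by
      rw [Subsingleton.elim j i, restrictTo_eq_self (hKJ i z hz)]
      exact hz
    rwa [Fintype.sum_subsingleton _ i] at this
  | succ s ih =>
    obtain ⟨t, htl, ht⟩ := hrip (Fin.last (s + 1)) (Fin.last_pos)
    obtain ⟨t, rfl⟩ : ∃ t' : Fin (s + 1), t = t'.castSucc := ⟨t.castPred htl.ne, by simp⟩
    set l := Fin.last (s + 1) with hl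
    have hsum : ∀ x : V → ℝ, ∑ i, eval x (f i) =
        ∑ i : Fin (s + 1), eval x (f i.castSucc) + eval x (f l) := fun x =>
      Fin.sum_univ_castSucc _
    have hC : ∀ k ∈ J l, ∀ i : Fin (s + 1), k ∈ J i.castSucc → k ∈ J l ∩ J t.castSucc :=
      fun k hk i hki => Finset.mem_inter.2 ⟨hk, ht k hk _ (Fin.castSucc_lt_last i) hki⟩
    obtain ⟨q, hqv, hq1, hq2⟩ := exists_polynomial_separating (J l ∩ J t.castSucc) (hK l)
      (isCompact_sparse (fun i : Fin (s + 1) => J i.castSucc) (fun i => K i.castSucc)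
        fun i => hK _) (f := fun z => eval z (f l))
      (G := fun w => -∑ i : Fin (s + 1), eval w (f i.castSucc))
      (MvPolynomial.continuous_eval _)
      (continuous_finsetSum _ fun i _ => MvPolynomial.continuous_eval _).neg (by
        intro z hz w hw hzw
        have hx1 : ∀ k ∈ J l, (fun k => if k ∈ J l then z k else w k) k = z k :=
          fun k hk => if_pos hk
        have hx2 : ∀ i : Fin (s + 1), ∀ k ∈ J i.castSucc,
            (fun k => if k ∈ J l then z k else w k) k = w k := by
          intro i k hk
          by_cases hkl : k ∈ J l
          · rw [hx1 k hkl, hzw k (hC k hkl i hk)]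
          · exact if_neg hkl
        have := hpos (fun k => if k ∈ J l then z k else w k) fun i => by
          refine Fin.lastCases ?_ (fun i => ?_) i
          · rw [restrictTo_congr hx1, restrictTo_eq_self (hKJ l z hz)]
            exact hz
          · rw [restrictTo_congr (hx2 i)]
            exact hw.2 i
        rw [hsum, eval_congr_of_vars_subset (hf l) hx1,
          Finset.sum_congr rfl fun i _ => eval_congr_of_vars_subset (hf i.castSucc) (hx2 i)] at this
        linarith)
    have hqt : q.vars ⊆ J t.castSucc := hqv.trans Finset.inter_subset_right
    obtain ⟨g, hg1, hg2, hg3⟩ := ih (fun i => J i.castSucc) (fun i => K i.castSucc)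
      (fun i => f i.castSucc + if i = t then q else 0) (by
        intro i hi
        obtain ⟨t', ht', h⟩ := hrip i.castSucc (Fin.castSucc_lt_castSucc_iff.2 hi)
        have ht'l : t' < l := ht'.trans (Fin.castSucc_lt_last i)
        obtain ⟨t', rfl⟩ : ∃ t'' : Fin (s + 1), t' = t''.castSucc := ⟨t'.castPred ht'l.ne, by simp⟩
        exact ⟨t', Fin.castSucc_lt_castSucc_iff.1 ht', fun k hk j hj hkj =>
          h k hk j.castSucc (Fin.castSucc_lt_castSucc_iff.2 hj) hkj⟩)
      (fun i => hK _) (fun i => hKJ _) (fun i => by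
        refine (vars_add_subset _ _).trans (Finset.union_subset (hf _) ?_)
        split_ifs with h
        · rw [h]; exact hqt
        · simp) (by
        intro x hx
        let U : Finset V := univ.biUnion fun i : Fin (s + 1) => J i.castSucc
        have hU : ∀ i : Fin (s + 1), ∀ k ∈ J i.castSucc, restrictTo U x k = x k := fun i k hk =>
          restrictTo_apply_of_mem (Finset.mem_biUnion.2 ⟨i, mem_univ i, hk⟩) x
        have := hq2 (restrictTo U x)
          ⟨fun k hk => restrictTo_apply_of_notMem (by simpa [U] using hk) x,
            fun i => by rw [restrictTo_congr (hU i)]; exact hx i⟩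
        rw [eval_congr_of_vars_subset hqt (hU t),
          Finset.sum_congr rfl fun i _ => eval_congr_of_vars_subset (hf i.castSucc) (hU i)] at this
        simp only [map_add, Finset.sum_add_distrib, apply_ite (eval x), map_zero,
          Finset.sum_ite_eq', mem_univ, if_true]
        linarith)
    refine ⟨Fin.lastCases (f l - q) g, fun i => ?_, ?_, fun i => ?_⟩
    · refine Fin.lastCases ?_ (fun i => ?_) i
      · simp only [Fin.lastCases_last]
        exact (vars_sub_subset _).trans
          (Finset.union_subset (hf _) (hqv.trans Finset.inter_subset_left))
      · simp only [Fin.lastCases_castSucc]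
        exact hg1 i
    · rw [Fin.sum_univ_castSucc, Fin.sum_univ_castSucc f]
      simp only [Fin.lastCases_last, Fin.lastCases_castSucc, hg2, Finset.sum_add_distrib,
        Finset.sum_ite_eq', mem_univ, if_true]
      ring
    · refine Fin.lastCases ?_ (fun i => ?_) i
      · intro z hz
        simp only [Fin.lastCases_last, map_sub]
        exact sub_pos.2 (hq1 z hz)
      · simp only [Fin.lastCases_castSucc]
        exact hg3 i

end

/-! ### Truncated and full quadratic modules in a block of variables -/

section

variable {V : Type*} {J : Finset V}

lemma SOSFull_add {p q : MvPolynomial V ℝ} (hp : p ∈ SOSFull J) (hq : q ∈ SOSFull J) :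
    p + q ∈ SOSFull J := by
  obtain ⟨t, a, ha, rfl⟩ := hp
  obtain ⟨t', b, hb, rfl⟩ := hq
  refine ⟨t + t', Fin.addCases a b, fun i => ?_, ?_⟩
  · refine Fin.addCases (fun i => ?_) (fun i => ?_) i
    · simpa only [Fin.addCases_left] using ha i
    · simpa only [Fin.addCases_right] using hb i
  · simp only [Fin.sum_univ_add, Fin.addCases_left, Fin.addCases_right]

lemma sq_mul_SOSFull {a p : MvPolynomial V ℝ} (ha : a.vars ⊆ J) (hp : p ∈ SOSFull J) :
    a ^ 2 * p ∈ SOSFull J := by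
  obtain ⟨t, b, hb, rfl⟩ := hp
  refine ⟨t, fun i => a * b i, fun i => (vars_mul _ _).trans (Finset.union_subset ha (hb i)), ?_⟩
  simp only [mul_pow, Finset.mul_sum]

lemma zero_mem_SOSFull : (0 : MvPolynomial V ℝ) ∈ SOSFull J :=
  ⟨0, Fin.elim0, fun i => i.elim0, by simp⟩

lemma one_mem_SOSFull : (1 : MvPolynomial V ℝ) ∈ SOSFull J :=
  ⟨1, fun _ => 1, fun _ => by simp, by simp⟩

lemma eval_nonneg_of_mem_SOSFull {p : MvPolynomial V ℝ} (hp : p ∈ SOSFull J) (x : V → ℝ) :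
    0 ≤ eval x p := by
  obtain ⟨t, b, -, rfl⟩ := hp
  simp only [map_sum, map_pow]
  exact Finset.sum_nonneg fun _ _ => sq_nonneg _

lemma vars_subset_of_mem_SOSFull {p : MvPolynomial V ℝ} (hp : p ∈ SOSFull J) : p.vars ⊆ J := by
  obtain ⟨t, b, hb, rfl⟩ := hp
  exact (vars_sum_subset _ _).trans
    (Finset.biUnion_subset.2 fun i _ => (vars_pow _ _).trans (hb i))

variable {ι κ : Type*} [Fintype ι] [Fintype κ] {hs : ι → MvPolynomial V ℝ}
  {gs : κ → MvPolynomial V ℝ}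

lemma IQFull_add {p q : MvPolynomial V ℝ} (hp : p ∈ IQFull J hs gs) (hq : q ∈ IQFull J hs gs) :
    p + q ∈ IQFull J hs gs := by
  obtain ⟨a, σ₀, σ, ha, h₀, hσ, rfl⟩ := hp
  obtain ⟨a', σ₀', σ', ha', h₀', hσ', rfl⟩ := hq
  refine ⟨a + a', σ₀ + σ₀', σ + σ', fun j => (vars_add_subset _ _).trans
    (Finset.union_subset (ha j) (ha' j)), SOSFull_add h₀ h₀',
    fun j => SOSFull_add (hσ j) (hσ' j), ?_⟩
  simp only [Pi.add_apply, mul_add, Finset.sum_add_distrib]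
  ring

lemma sq_mul_IQFull {b p : MvPolynomial V ℝ} (hb : b.vars ⊆ J) (hp : p ∈ IQFull J hs gs) :
    b ^ 2 * p ∈ IQFull J hs gs := by
  obtain ⟨a, σ₀, σ, ha, h₀, hσ, rfl⟩ := hp
  refine ⟨fun j => b ^ 2 * a j, b ^ 2 * σ₀, fun j => b ^ 2 * σ j, fun j => (vars_mul _ _).trans
    (Finset.union_subset ((vars_pow _ _).trans hb) (ha j)), sq_mul_SOSFull hb h₀,
    fun j => sq_mul_SOSFull hb (hσ j), ?_⟩
  simp only [mul_add, Finset.mul_sum, mul_left_comm]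

lemma one_mem_IQFull : (1 : MvPolynomial V ℝ) ∈ IQFull J hs gs :=
  ⟨0, 1, 0, fun _ => by simp, one_mem_SOSFull, fun _ => zero_mem_SOSFull, by simp⟩

lemma mul_mem_IQFull (j : ι) {a : MvPolynomial V ℝ} (ha : a.vars ⊆ J) :
    hs j * a ∈ IQFull J hs gs := by
  refine ⟨Pi.single j a, 0, 0, fun i => ?_, zero_mem_SOSFull, fun _ => zero_mem_SOSFull, ?_⟩
  · rcases eq_or_ne i j with rfl | h
    · simpa using ha
    · simp [h]
  · simp [Pi.single_apply]

lemma ineq_mem_IQFull (j : κ) : gs j ∈ IQFull J hs gs := by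
  refine ⟨0, 0, Pi.single j 1, fun i => by simp, zero_mem_SOSFull, fun i => ?_, ?_⟩
  · rcases eq_or_ne i j with rfl | h
    · simpa using one_mem_SOSFull
    · simpa [h] using zero_mem_SOSFull
  · simp [Pi.single_apply]

lemma eval_nonneg_of_mem_IQFull {p : MvPolynomial V ℝ} (hp : p ∈ IQFull J hs gs) {x : V → ℝ}
    (hx : ∀ j, eval x (hs j) = 0) (hx' : ∀ j, 0 ≤ eval x (gs j)) : 0 ≤ eval x p := by
  obtain ⟨a, σ₀, σ, ha, h₀, hσ, rfl⟩ := hp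
  simp only [map_add, map_sum, map_mul, hx, zero_mul, Finset.sum_const_zero, zero_add]
  exact add_nonneg (eval_nonneg_of_mem_SOSFull h₀ x) (Finset.sum_nonneg fun j _ =>
    mul_nonneg (hx' j) (eval_nonneg_of_mem_SOSFull (hσ j) x))

lemma vars_subset_of_mem_IQFull (hhs : ∀ j, (hs j).vars ⊆ J) (hgs : ∀ j, (gs j).vars ⊆ J)
    {p : MvPolynomial V ℝ} (hp : p ∈ IQFull J hs gs) : p.vars ⊆ J := by
  obtain ⟨a, σ₀, σ, ha, h₀, hσ, rfl⟩ := hp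
  refine (vars_add_subset _ _).trans (Finset.union_subset ((vars_add_subset _ _).trans
    (Finset.union_subset ?_ (vars_subset_of_mem_SOSFull h₀))) ?_)
  · exact (vars_sum_subset _ _).trans (Finset.biUnion_subset.2 fun j _ =>
      (vars_mul _ _).trans (Finset.union_subset (hhs j) (ha j)))
  · exact (vars_sum_subset _ _).trans (Finset.biUnion_subset.2 fun j _ =>
      (vars_mul _ _).trans (Finset.union_subset (hgs j) (vars_subset_of_mem_SOSFull (hσ j))))

/-- The zero extension of a point with coordinates in `J`. -/
def zeroExtend (J : Finset V) (y : {k : V // k ∈ J} → ℝ) : V → ℝ :=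
  fun k => if hk : k ∈ J then y ⟨k, hk⟩ else 0

lemma continuous_zeroExtend (J : Finset V) : Continuous (zeroExtend J) := by
  refine continuous_pi fun k => ?_
  by_cases hk : k ∈ J
  · simp only [zeroExtend, dif_pos hk]
    exact continuous_apply _
  · simp only [zeroExtend, dif_neg hk]
    exact continuous_const

lemma eval_zeroExtend (y : {k : V // k ∈ J} → ℝ) (p : MvPolynomial {k : V // k ∈ J} ℝ) :
    eval (zeroExtend J y) (rename Subtype.val p) = eval y p := by
  rw [eval_rename]
  congr 2
  ext k
  simp [zeroExtend]

lemma exists_rename_val_eq {p : MvPolynomial V ℝ} (hp : p.vars ⊆ J) :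
    ∃ q : MvPolynomial {k : V // k ∈ J} ℝ, rename Subtype.val q = p :=
  exists_rename_eq_of_vars_subset_range p Subtype.val Subtype.val_injective (by simpa using hp)

lemma vars_rename_val_subset (p : MvPolynomial {k : V // k ∈ J} ℝ) :
    (rename Subtype.val p).vars ⊆ J := by
  intro k hk
  obtain ⟨i, -, rfl⟩ := Finset.mem_image.1 (vars_rename _ _ hk)
  exact i.2

/-- The points supported on `J` at which `hs` vanishes and `gs` is nonnegative. -/
def blockSet (J : Finset V) (hs : ι → MvPolynomial V ℝ) (gs : κ → MvPolynomial V ℝ) :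
    Set (V → ℝ) :=
  {z | (∀ k ∉ J, z k = 0) ∧ (∀ j, eval z (hs j) = 0) ∧ ∀ j, 0 ≤ eval z (gs j)}

lemma isCompact_blockSet {p : MvPolynomial V ℝ} (hp : p ∈ IQFull J hs gs)
    (hcomp : IsCompact {y : {k : V // k ∈ J} → ℝ | 0 ≤ eval (zeroExtend J y) p}) :
    IsCompact (blockSet J hs gs) := by
  refine (hcomp.image (continuous_zeroExtend J)).of_isClosed_subset ?_ ?_
  · have e : blockSet J hs gs = (⋂ k ∈ {k | k ∉ J}, {z | z k = 0}) ∩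
        ((⋂ j, {z | eval z (hs j) = 0}) ∩ ⋂ j, {z | 0 ≤ eval z (gs j)}) := by
      ext z
      simp [blockSet]
    rw [e]
    refine IsClosed.inter (isClosed_biInter fun k _ => isClosed_eq (continuous_apply k)
      continuous_const) (IsClosed.inter (isClosed_iInter fun j => ?_)
      (isClosed_iInter fun j => ?_))
    · exact isClosed_eq (MvPolynomial.continuous_eval _) continuous_const
    · exact isClosed_le continuous_const (MvPolynomial.continuous_eval _)
  · rintro z ⟨h1, h2, h3⟩
    have e : zeroExtend J (fun k => z k) = z := by
      ext k
      by_cases hk : k ∈ J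
      · simp [zeroExtend, hk]
      · simp [zeroExtend, hk, h1 k hk]
    refine ⟨fun k => z k, ?_, e⟩
    change 0 ≤ eval (zeroExtend J (fun k => z k)) p
    rw [e]
    exact eval_nonneg_of_mem_IQFull hp h2 h3

end

section

variable {V : Type} {J : Finset V} {ι κ : Type*} [Fintype ι] [Fintype κ]
  {hs : ι → MvPolynomial V ℝ} {gs : κ → MvPolynomial V ℝ}

/-- Putinar's Positivstellensatz for a block of variables. -/
theorem mem_IQFull_of_pos (hhs : ∀ j, (hs j).vars ⊆ J) (hgs : ∀ j, (gs j).vars ⊆ J)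
    {p : MvPolynomial V ℝ} (hp : p ∈ IQFull J hs gs)
    (hcomp : IsCompact {y : {k : V // k ∈ J} → ℝ | 0 ≤ eval (zeroExtend J y) p})
    {f : MvPolynomial V ℝ} (hf : f.vars ⊆ J) (hpos : ∀ z ∈ blockSet J hs gs, 0 < eval z f) :
    f ∈ IQFull J hs gs := by
  let M : Set (MvPolynomial {k : V // k ∈ J} ℝ) := {a | rename Subtype.val a ∈ IQFull J hs gs}
  have hM : IsQuadraticModule M := by
    refine ⟨fun {a b} ha hb => ?_, ?_, fun a b hb => ?_⟩
    · change rename Subtype.val (a + b) ∈ IQFull J hs gs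
      rw [map_add]
      exact IQFull_add ha hb
    · change rename Subtype.val (1 : MvPolynomial {k : V // k ∈ J} ℝ) ∈ IQFull J hs gs
      rw [map_one]
      exact one_mem_IQFull
    · change rename Subtype.val (a ^ 2 * b) ∈ IQFull J hs gs
      rw [map_mul, map_pow]
      exact sq_mul_IQFull (vars_rename_val_subset a) hb
  obtain ⟨p, rfl⟩ := exists_rename_val_eq (vars_subset_of_mem_IQFull hhs hgs hp)
  simp only [eval_zeroExtend] at hcomp
  have harch := hM.archimedean_of_bounded (p := p) hp hcomp.isBounded
  obtain ⟨f, rfl⟩ := exists_rename_val_eq hf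
  refine hM.mem_of_eval_pos harch (f := f) fun y hy => ?_
  have hy' : ∀ q ∈ IQFull J hs gs, 0 ≤ eval (zeroExtend J y) q := by
    intro q hq
    obtain ⟨q, rfl⟩ := exists_rename_val_eq (vars_subset_of_mem_IQFull hhs hgs hq)
    rw [eval_zeroExtend]
    exact hy q hq
  rw [← eval_zeroExtend]
  refine hpos _ ⟨fun k hk => dif_neg hk, fun j => le_antisymm ?_ ?_, fun j =>
    hy' _ (ineq_mem_IQFull j)⟩
  · have := hy' _ (mul_mem_IQFull (hs := hs) (gs := gs) j (a := -1) (by simp))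
    simpa using this
  · have := hy' _ (mul_mem_IQFull (hs := hs) (gs := gs) j (a := 1) (by simp))
    simpa using this

/-- The sparse version of Putinar's Positivstellensatz. -/
theorem exists_sparse_certificate [Fintype V] {s : ℕ} (J : Fin (s + 1) → Finset V)
    (hrip : ∀ i, 0 < i → ∃ t < i, ∀ k ∈ J i, ∀ j < i, k ∈ J j → k ∈ J t)
    {ι κ : Fin (s + 1) → Type} [∀ i, Fintype (ι i)] [∀ i, Fintype (κ i)]
    (hs : ∀ i, ι i → MvPolynomial V ℝ) (gs : ∀ i, κ i → MvPolynomial V ℝ)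
    (hhs : ∀ i j, (hs i j).vars ⊆ J i) (hgs : ∀ i j, (gs i j).vars ⊆ J i)
    (harch : ∀ i, ∃ p ∈ IQFull (J i) (hs i) (gs i),
      IsCompact {y : {k : V // k ∈ J i} → ℝ | 0 ≤ eval (zeroExtend (J i) y) p})
    (f : Fin (s + 1) → MvPolynomial V ℝ) (hf : ∀ i, (f i).vars ⊆ J i)
    (hpos : ∀ x : V → ℝ, (∀ i, (∀ j, eval x (hs i j) = 0) ∧ ∀ j, 0 ≤ eval x (gs i j)) →
      0 < ∑ i, eval x (f i)) :
    ∃ f' : Fin (s + 1) → MvPolynomial V ℝ, (∀ i, f' i ∈ IQFull (J i) (hs i) (gs i)) ∧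
      ∑ i, f' i = ∑ i, f i := by
  choose p hp hcomp using harch
  obtain ⟨f', h1, h2, h3⟩ := exists_sparse_pos_splitting s J
    (fun i => blockSet (J i) (hs i) (gs i)) f hrip
    (fun i => isCompact_blockSet (hp i) (hcomp i)) (fun i z hz => hz.1) hf (by
      intro x hx
      refine hpos x fun i => ⟨fun j => ?_, fun j => ?_⟩
      · rw [eval_congr_of_vars_subset (hhs i j) fun k hk => (restrictTo_apply_of_mem hk x).symm]
        exact (hx i).2.1 j
      · rw [eval_congr_of_vars_subset (hgs i j) fun k hk => (restrictTo_apply_of_mem hk x).symm]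
        exact (hx i).2.2 j)
  exact ⟨f', fun i => mem_IQFull_of_pos (hhs i) (hgs i) (hp i) (hcomp i) (h1 i) (h3 i), h2⟩

end

/-! ### Flows along the arcs -/

section

variable {s : ℕ} {P : Fin s → Fin s → Prop}

/-- The divergence of `ν` at `i` along the arcs of `P`. -/
def divergence (P : Fin s → Fin s → Prop) (ν : Fin s → Fin s → ℝ) (i : Fin s) : ℝ :=
  (∑ t, if P i t then ν i t else 0) - ∑ t, if P t i then ν t i else 0

lemma divergence_add (ν ν' : Fin s → Fin s → ℝ) (i : Fin s) :
    divergence P (ν + ν') i = divergence P ν i + divergence P ν' i := by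
  have h : ∀ (p : Prop) (a b : ℝ),
      (if p then a + b else 0) = (if p then a else 0) + if p then b else 0 := by
    intro p a b
    split_ifs <;> simp
  simp only [divergence, Pi.add_apply, h, Finset.sum_add_distrib]
  ring

lemma divergence_sum {τ : Type*} (T : Finset τ) (a : τ → ℝ) (ν : τ → Fin s → Fin s → ℝ)
    (i : Fin s) :
    divergence P (fun j t => ∑ b ∈ T, a b * ν b j t) i = ∑ b ∈ T, a b * divergence P (ν b) i := by
  have h : ∀ (p : Prop) (w : τ → ℝ),
      (if p then ∑ b ∈ T, a b * w b else 0) = ∑ b ∈ T, a b * if p then w b else 0 := by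
    intro p w
    split_ifs <;> simp
  simp only [divergence, h, mul_sub, Finset.sum_sub_distrib, Finset.mul_sum]
  rw [Finset.sum_comm]
  congr 1
  rw [Finset.sum_comm]

lemma divergence_single {i t : Fin s} (h : P i t) (j : Fin s) :
    divergence P (fun a b => if a = i ∧ b = t then 1 else 0) j =
      (if j = i then 1 else 0) - if j = t then 1 else 0 := by
  have e₁ : ∀ b, (if P j b then (if j = i ∧ b = t then (1 : ℝ) else 0) else 0) =
      if b = t then (if j = i then 1 else 0) else 0 := by
    intro b
    split_ifs <;> simp_all
  have e₂ : ∀ a, (if P a j then (if a = i ∧ j = t then (1 : ℝ) else 0) else 0) =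
      if a = i then (if j = t then 1 else 0) else 0 := by
    intro a
    split_ifs <;> simp_all
  simp only [divergence, e₁, e₂, Finset.sum_ite_eq', Finset.mem_univ, if_true]

/-- If every node other than the root has an arc to an earlier node, unit flows to the root
exist. -/
lemma exists_flow_to_root {S : Set (Fin s)} {i₀ : Fin s}
    (hP : ∀ i ∈ S, i ≠ i₀ → ∃ t < i, P i t ∧ t ∈ S) (i : Fin s) (hi : i ∈ S) :
    ∃ ν, ∀ j, divergence P ν j = (if j = i then 1 else 0) - if j = i₀ then 1 else 0 := by
  induction i using WellFoundedLT.induction with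
  | ind i ih =>
    by_cases h : i = i₀
    · subst h
      exact ⟨0, fun j => by simp [divergence]⟩
    · obtain ⟨t, hlt, hPt, ht⟩ := hP i hi h
      obtain ⟨ν, hν⟩ := ih t hlt ht
      refine ⟨ν + fun a b => if a = i ∧ b = t then 1 else 0, fun j => ?_⟩
      rw [divergence_add, hν, divergence_single hPt]
      ring

/-- A balanced demand supported on a rooted set of nodes is the divergence of a flow. -/
lemma exists_flow {S : Set (Fin s)} {i₀ : Fin s}
    (hP : ∀ i ∈ S, i ≠ i₀ → ∃ t < i, P i t ∧ t ∈ S) (r : Fin s → ℝ) (hr : ∀ i ∉ S, r i = 0)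
    (hsum : ∑ i, r i = 0) : ∃ ν, ∀ j, divergence P ν j = r j := by
  choose! ν hν using exists_flow_to_root hP
  refine ⟨fun j t => ∑ i, r i * ν i j t, fun j => ?_⟩
  rw [divergence_sum]
  have e : ∀ i, r i * divergence P (ν i) j =
      r i * ((if j = i then 1 else 0) - if j = i₀ then 1 else 0) := by
    intro i
    by_cases hi : i ∈ S
    · rw [hν i hi]
    · rw [hr i hi, zero_mul, zero_mul]
  simp only [e, mul_sub, Finset.sum_sub_distrib, ← Finset.sum_mul, hsum]
  simp

end

section

variable {n s : ℕ} {I : Fin s → Finset (Fin n)}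

lemma mem_prevUnion {α : Type*} {J : Fin s → Finset α} {i : Fin s} {k : α} :
    k ∈ prevUnion J i ↔ ∃ j < i, k ∈ J j := by
  simp [prevUnion]

/-- Under the RIP, the arcs lead from every block containing `k` to the first such block. -/
lemma RIP.exists_arc (hrip : RIP I) {k : Fin n} {i j : Fin s} (hj : j < i) (hki : k ∈ I i)
    (hkj : k ∈ I j) : ∃ t < i, Arc I i t ∧ k ∈ I t := by
  have hk : k ∈ I i ∩ prevUnion I i := Finset.mem_inter.2 ⟨hki, mem_prevUnion.2 ⟨j, hj, hkj⟩⟩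
  obtain ⟨t₀, ht₀⟩ := hrip i (lt_of_le_of_lt (Nat.zero_le _) (Fin.lt_def.1 hj))
  obtain ⟨t, ht, hmax⟩ := Finset.exists_max_image
    (Finset.univ.filter fun t => t < i ∧ I i ∩ prevUnion I i ⊆ I t) id ⟨t₀, by simpa using ht₀⟩
  simp only [Finset.mem_filter, Finset.mem_univ, true_and, id] at ht hmax
  exact ⟨t, ht.1, ⟨ht.1, ⟨k, hk⟩, ht.2, fun t' h h' hsub =>
    (hmax t' ⟨h', hsub⟩).not_gt h⟩, ht.2 hk⟩

/-- Existence of consensus multipliers splitting a balanced gradient. -/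
lemma RIP.exists_multipliers (hrip : RIP I) (hcover : ∀ k, ∃ i, k ∈ I i)
    (r : Fin s → Fin n → ℝ) (hr : ∀ i k, k ∉ I i → r i k = 0) (hsum : ∀ k, ∑ i, r i k = 0) :
    ∃ ν : Fin s × Fin s × Fin n → ℝ, ∀ i k,
      divergence (fun i t => Arc I i t ∧ k ∈ I i ∩ I t) (fun i t => ν (i, t, k)) i = r i k := by
  have key : ∀ k, ∃ ν, ∀ i, divergence (fun i t => Arc I i t ∧ k ∈ I i ∩ I t) ν i = r i k := by
    intro k
    obtain ⟨i₁, hi₁⟩ := hcover k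
    obtain ⟨i₀, hi₀, hmin⟩ := Finset.exists_min_image
      (Finset.univ.filter fun i => k ∈ I i) id ⟨i₁, by simpa using hi₁⟩
    simp only [Finset.mem_filter, Finset.mem_univ, true_and, id] at hi₀ hmin
    refine exists_flow (S := {i | k ∈ I i}) (i₀ := i₀) (fun i hi hne => ?_) _
      (fun i hi => hr i k hi) (hsum k)
    obtain ⟨t, hlt, harc, hkt⟩ := hrip.exists_arc (lt_of_le_of_ne (hmin i hi) hne.symm) hi hi₀
    exact ⟨t, hlt, ⟨harc, Finset.mem_inter.2 ⟨hi, hkt⟩⟩, hkt⟩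
  choose ν hν using key
  exact ⟨fun q => ν q.2.2 q.1 q.2.1, fun i k => hν k i⟩

lemma eval_FpolyP (f : Fin s → MvPolynomial (Fin n) ℝ) (x : Fin n → ℝ)
    (ν : Fin s × Fin s × Fin n → ℝ) (i : Fin s) (k : Fin n) :
    eval (Sum.elim x ν) (FpolyP I f i k) = eval x (pderiv k (f i)) -
      divergence (fun i t => Arc I i t ∧ k ∈ I i ∩ I t) (fun i t => ν (i, t, k)) i := by
  have h : ∀ (p : Prop) (hp : Decidable p) (a : Fin s × Fin s × Fin n),
      eval (Sum.elim x ν) (if p then X (Sum.inr a) else 0) =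
        @ite _ p (Classical.propDecidable p) (ν a) 0 := by
    intro p hp a
    split_ifs <;> simp
  simp only [FpolyP, map_add, map_sub, map_sum, h, divergence, eval_rename, Sum.elim_comp_inl]
  rw [sub_sub_eq_add_sub, sub_add_eq_add_sub]
  congr!

end

/-! ### Evaluation and truncation of the reformulated quadratic modules -/

section

variable {V W : Type*}

lemma eval_nonneg_of_mem_SOSdeg {J : Finset V} {e : ℕ} {p : MvPolynomial V ℝ}
    (hp : p ∈ SOSdeg J e) (x : V → ℝ) : 0 ≤ eval x p := by
  obtain ⟨t, b, -, rfl⟩ := hp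
  simp only [map_sum, map_pow]
  exact Finset.sum_nonneg fun _ _ => sq_nonneg _

lemma eval_nonneg_of_mem_IQdeg {ι κ : Type*} [Fintype ι] [Fintype κ] {J : Finset V}
    {hs : ι → MvPolynomial V ℝ} {gs : κ → MvPolynomial V ℝ} {e : ℕ} {p : MvPolynomial V ℝ}
    (hp : p ∈ IQdeg J hs gs e) {x : V → ℝ} (h₁ : ∀ j, eval x (hs j) = 0)
    (h₂ : ∀ j, 0 ≤ eval x (gs j)) : 0 ≤ eval x p := by
  obtain ⟨q, σ₀, σ, -, h₀, hσ, rfl⟩ := hp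
  simp only [map_add, map_sum, map_mul, h₁, zero_mul, Finset.sum_const_zero, zero_add]
  exact add_nonneg (eval_nonneg_of_mem_SOSdeg h₀ x)
    (Finset.sum_nonneg fun j _ => mul_nonneg (h₂ j) (eval_nonneg_of_mem_SOSdeg (hσ j) x))

lemma zero_mem_SOSdeg {J : Finset V} {e : ℕ} : (0 : MvPolynomial V ℝ) ∈ SOSdeg J e :=
  ⟨0, Fin.elim0, fun i => i.elim0, by simp⟩

variable {φ : V → W} {J : Finset V} {J' : Finset W}

lemma vars_rename_subset_of_mapsTo (hφ : ∀ k ∈ J, φ k ∈ J') {p : MvPolynomial V ℝ}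
    (hp : p.vars ⊆ J) : (rename φ p).vars ⊆ J' := by
  intro k hk
  obtain ⟨i, hi, rfl⟩ := Finset.mem_image.1 (vars_rename _ _ hk)
  exact hφ i (hp hi)

lemma eventually_rename_mem_SOSdeg (hφ : ∀ k ∈ J, φ k ∈ J') {p : MvPolynomial V ℝ}
    (hp : p ∈ SOSFull J) : ∀ᶠ e in Filter.atTop, rename φ p ∈ SOSdeg J' e := by
  obtain ⟨t, q, hq, rfl⟩ := hp
  have h : ∀ᶠ e in Filter.atTop, ∀ a, 2 * (rename φ (q a)).totalDegree ≤ e :=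
    Filter.eventually_all.2 fun a => Filter.eventually_ge_atTop _
  filter_upwards [h] with e he
  exact ⟨t, fun a => rename φ (q a),
    fun a => ⟨vars_rename_subset_of_mapsTo hφ (hq a), he a⟩, by simp⟩

/-- A certificate without degree bounds is a certificate for all large truncation orders, also
when more constraints are added. -/
lemma eventually_rename_mem_IQdeg (hφ : ∀ k ∈ J, φ k ∈ J') {ι ι₁ ι₂ κ κ₁ : Type*} [Fintype ι]
    [Fintype ι₁] [Fintype ι₂] [Fintype κ] [Fintype κ₁] {hs : ι → MvPolynomial V ℝ}
    {gs : κ → MvPolynomial V ℝ} {a : ι₁ → MvPolynomial W ℝ} {b : ι₂ → MvPolynomial W ℝ}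
    {a' : κ₁ → MvPolynomial W ℝ} {p : MvPolynomial V ℝ} (hp : p ∈ IQFull J hs gs) :
    ∀ᶠ e in Filter.atTop, rename φ p ∈ IQdeg J'
      (Sum.elim a (Sum.elim (fun j => rename φ (hs j)) b))
      (Sum.elim a' (fun j => rename φ (gs j))) e := by
  obtain ⟨q, σ₀, σ, hq, h₀, hσ, rfl⟩ := hp
  have hdeg : ∀ᶠ e in Filter.atTop, ∀ j,
      (rename φ (q j)).totalDegree ≤ e - (rename φ (hs j)).totalDegree :=
    Filter.eventually_all.2 fun j => (Filter.tendsto_sub_atTop_nat _).eventually_ge_atTop _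
  have hσ' : ∀ᶠ e in Filter.atTop, ∀ j,
      rename φ (σ j) ∈ SOSdeg J' (e - (rename φ (gs j)).totalDegree) :=
    Filter.eventually_all.2 fun j =>
      (Filter.tendsto_sub_atTop_nat _).eventually (eventually_rename_mem_SOSdeg hφ (hσ j))
  filter_upwards [hdeg, hσ', eventually_rename_mem_SOSdeg hφ h₀] with e h1 h2 h3
  refine ⟨Sum.elim (fun _ => 0) (Sum.elim (fun j => rename φ (q j)) fun _ => 0), rename φ σ₀,
    Sum.elim (fun _ => 0) fun j => rename φ (σ j), ?_, h3, ?_, ?_⟩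
  · rintro (j | j | j)
    · simp
    · exact ⟨vars_rename_subset_of_mapsTo hφ (hq j), h1 j⟩
    · simp
  · rintro (j | j)
    · exact zero_mem_SOSdeg
    · exact h2 j
  · simp [Fintype.sum_sum_type]

end

/-! ### Convergence of the relaxations -/

section

variable {n s : ℕ} {I : Fin s → Finset (Fin n)} {m ℓ : Fin s → ℕ}
  {f : Fin s → MvPolynomial (Fin n) ℝ} {c : ∀ i, Fin (m i + ℓ i) → MvPolynomial (Fin n) ℝ}
  {L : ∀ i, Fin (m i + ℓ i) → Fin n → MvPolynomial (Fin n) ℝ}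
  {D : ∀ i, Fin (m i + ℓ i) → Fin (m i + ℓ i) → MvPolynomial (Fin n) ℝ}

/-- At a KKT pair, the multiplier expressions evaluate to the multipliers. -/
lemma eval_pPoly_eq {i : Fin s}
    (hLD : ∀ j j' : Fin (m i + ℓ i),
      (∑ k ∈ I i, L i j k * pderiv k (c i j')) + D i j j' * c i j' = if j = j' then 1 else 0)
    {x : Fin n → ℝ} {ν : Fin s × Fin s × Fin n → ℝ} {lam : Fin (m i + ℓ i) → ℝ}
    (hF : ∀ k, eval (Sum.elim x ν) (FpolyP I f i k) =
      ∑ j, lam j * eval x (pderiv k (c i j)))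
    (hcompl : ∀ j, lam j * eval x (c i j) = 0) (j : Fin (m i + ℓ i)) :
    eval (Sum.elim x ν) (pPoly I f L i j) = lam j := by
  have h : ∀ j', lam j' * ∑ k ∈ I i, eval x (L i j k) * eval x (pderiv k (c i j')) =
      if j = j' then lam j' else 0 := by
    intro j'
    have e := congrArg (eval x) (hLD j j')
    rw [apply_ite (eval x), map_one, map_zero, map_add, map_sum] at e
    simp only [map_mul] at e
    rw [eq_sub_of_add_eq e, mul_sub, mul_left_comm, hcompl, mul_zero, sub_zero, mul_ite, mul_one,
      mul_zero]
  simp only [pPoly, map_sum, map_mul, eval_rename, Sum.elim_comp_inl, hF, Finset.mul_sum] at h ⊢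
  rw [Finset.sum_comm]
  calc _ = ∑ j', ∑ k ∈ I i, lam j' * (eval x (L i j k) * eval x (pderiv k (c i j'))) :=
        Finset.sum_congr rfl fun j' _ => Finset.sum_congr rfl fun k _ => by ring
    _ = lam j := by simp [h]

/-- A KKT pair extends to a feasible point of the reformulation. -/
lemma RIP.exists_reformulation_point (hrip : RIP I) (hcover : ∀ k, ∃ i, k ∈ I i)
    (hf : ∀ i, (f i).vars ⊆ I i) (hc : ∀ i j, (c i j).vars ⊆ I i)
    (hLD : ∀ i (j j' : Fin (m i + ℓ i)),
      (∑ k ∈ I i, L i j k * pderiv k (c i j')) + D i j j' * c i j' = if j = j' then 1 else 0)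
    {x : Fin n → ℝ} {lam : ∀ i, Fin (m i + ℓ i) → ℝ}
    (hgrad : ∀ k, ∑ i, eval x (pderiv k (f i)) =
      ∑ i, ∑ j, lam i j * eval x (pderiv k (c i j)))
    (heq : ∀ i (j : Fin (ℓ i)), eval x (c i (Fin.natAdd (m i) j)) = 0)
    (hineq : ∀ i (j : Fin (m i)), 0 ≤ lam i (Fin.castAdd (ℓ i) j) ∧
      0 ≤ eval x (c i (Fin.castAdd (ℓ i) j)) ∧
      lam i (Fin.castAdd (ℓ i) j) * eval x (c i (Fin.castAdd (ℓ i) j)) = 0) :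
    ∃ ν, ∀ i, (∀ j, eval (Sum.elim x ν) (phiP I f c L i j) = 0) ∧
      ∀ j, 0 ≤ eval (Sum.elim x ν) (psiP I f c L i j) := by
  have hpd : ∀ {i k}, k ∉ I i → ∀ {p : MvPolynomial (Fin n) ℝ}, p.vars ⊆ I i →
      pderiv k p = 0 := fun hk _ hp => pderiv_eq_zero_of_notMem_vars fun h => hk (hp h)
  obtain ⟨ν, hν⟩ := hrip.exists_multipliers hcover
    (fun i k => eval x (pderiv k (f i)) - ∑ j, lam i j * eval x (pderiv k (c i j)))
    (fun i k hk => by simp [hpd hk (hf i), hpd hk (hc i _)])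
    (fun k => by rw [Finset.sum_sub_distrib, hgrad, sub_self])
  have hF : ∀ i k, eval (Sum.elim x ν) (FpolyP I f i k) =
      ∑ j, lam i j * eval x (pderiv k (c i j)) := by
    intro i k
    rw [eval_FpolyP, hν, sub_sub_cancel]
  have hcompl : ∀ i j, lam i j * eval x (c i j) = 0 := by
    intro i j
    refine Fin.addCases (fun j => (hineq i j).2.2) (fun j => ?_) j
    rw [heq, mul_zero]
  have hp := fun i j => eval_pPoly_eq (hLD i) (hF i) (hcompl i) j
  refine ⟨ν, fun i => ⟨?_, ?_⟩⟩
  · rintro (k | j | j)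
    · simp [phiP, hF, hp, eval_rename, Sum.elim_comp_inl]
    · simpa [phiP, eval_rename, Sum.elim_comp_inl] using heq i j
    · simp only [phiP, Sum.elim_inr, map_mul, hp, eval_rename, Sum.elim_comp_inl, hcompl]
  · rintro (j | j)
    · simpa [psiP, hp] using (hineq i j).1
    · simpa [psiP, eval_rename, Sum.elim_comp_inl] using (hineq i j).2.1

/-- Under the RIP, positivity on the feasible set gives certificates of all large orders for the
reformulation. -/
lemma RIP.eventually_exists_certificate [NeZero s] (hrip : RIP I) (hf : ∀ i, (f i).vars ⊆ I i)
    (hc : ∀ i j, (c i j).vars ⊆ I i)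
    (harch : ∀ i : Fin s, ∃ p ∈ IQFull (I i) (fun j : Fin (ℓ i) => c i (Fin.natAdd (m i) j))
        (fun j : Fin (m i) => c i (Fin.castAdd (ℓ i) j)),
      IsCompact {y : {k : Fin n // k ∈ I i} → ℝ | 0 ≤ eval (zeroExtend (I i) y) p})
    {γ : ℝ} (hγ : ∀ x : Fin n → ℝ, (∀ i, (∀ j : Fin (ℓ i), eval x (c i (Fin.natAdd (m i) j)) = 0) ∧
      ∀ j : Fin (m i), 0 ≤ eval x (c i (Fin.castAdd (ℓ i) j))) → γ < ∑ i, eval x (f i)) :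
    ∀ᶠ d : ℕ in Filter.atTop, ∃ u : Fin s → MvPolynomial (BigVar n s) ℝ,
      (∀ i, u i ∈ IQdeg (hatI I i) (phiP I f c L i) (psiP I f c L i) (2 * d)) ∧
      (∑ i, (rename Sum.inl (f i) : MvPolynomial (BigVar n s) ℝ)) - C γ = ∑ i, u i := by
  obtain ⟨s, rfl⟩ := Nat.exists_eq_succ_of_ne_zero (NeZero.ne s)
  obtain ⟨f', hf', hsum⟩ := exists_sparse_certificate I (fun i hi => by
      obtain ⟨t, ht, hsub⟩ := hrip i hi
      exact ⟨t, ht, fun k hk j hj hkj =>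
        hsub (Finset.mem_inter.2 ⟨hk, mem_prevUnion.2 ⟨j, hj, hkj⟩⟩)⟩)
    (fun i (j : Fin (ℓ i)) => c i (Fin.natAdd (m i) j))
    (fun i (j : Fin (m i)) => c i (Fin.castAdd (ℓ i) j)) (fun i _ => hc i _) (fun i _ => hc i _)
    harch (fun i => f i - C (if i = 0 then γ else 0))
    (fun i => (vars_sub_subset _).trans (Finset.union_subset (hf i) (by simp)))
    (fun x hx => by simpa [Finset.sum_sub_distrib] using hγ x hx)
  have h : ∀ᶠ e in Filter.atTop, ∀ i, rename Sum.inl (f' i) ∈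
      IQdeg (hatI I i) (phiP I f c L i) (psiP I f c L i) e :=
    Filter.eventually_all.2 fun i =>
      eventually_rename_mem_IQdeg (fun k hk => by simp [hatI, hk]) (hf' i)
  have ht : Filter.Tendsto (fun d : ℕ => 2 * d) Filter.atTop Filter.atTop :=
    Filter.tendsto_id.const_mul_atTop' two_pos
  filter_upwards [ht.eventually h] with d hd
  refine ⟨fun i => rename Sum.inl (f' i), hd, ?_⟩
  have e := congrArg (rename (Sum.inl : Fin n → BigVar n (s + 1))) hsum
  simp only [map_sum, map_sub, rename_C, Finset.sum_sub_distrib] at e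
  rw [e]
  congr 1
  rw [← map_sum]
  simp

end
/-- Theorem 4.2: assume (1) at least one minimizer of (P) is a KKT
point, (2) the RIP holds, (3) each `IQ_{I_i}(h^{(i)}, g^{(i)})` is archimedean, and
Assumption 3.1 holds.  Then the optimal values `ϑ_d` of the correlative sparse SOS
relaxations of the CS-LME reformulation converge to `f_min` as `d → ∞`. -/
theorem cs_lme_asymptotic_convergence
    (n s : ℕ) (I : Fin s → Finset (Fin n))
    (hcover : ∀ k : Fin n, ∃ i, k ∈ I i) (hrip : RIP I)
    (m ℓ : Fin s → ℕ)
    (f : Fin s → MvPolynomial (Fin n) ℝ)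
    (c : ∀ i, Fin (m i + ℓ i) → MvPolynomial (Fin n) ℝ)
    (hf : ∀ i, (f i).vars ⊆ I i) (hc : ∀ i j, (c i j).vars ⊆ I i)
    -- Assumption 3.1
    (L : ∀ i, Fin (m i + ℓ i) → Fin n → MvPolynomial (Fin n) ℝ)
    (D : ∀ i, Fin (m i + ℓ i) → Fin (m i + ℓ i) → MvPolynomial (Fin n) ℝ)
    (hL : ∀ i j k, (L i j k).vars ⊆ I i) (hD : ∀ i j j', (D i j j').vars ⊆ I i)
    (hLD : ∀ i (j j' : Fin (m i + ℓ i)),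
      (∑ k ∈ I i, L i j k * pderiv k (c i j')) + D i j j' * c i j'
        = if j = j' then 1 else 0)
    -- (3): each IQ_{I_i}(h^{(i)}, g^{(i)}) is archimedean
    (harch : ∀ i : Fin s, ∃ p ∈ IQFull (I i)
        (fun j : Fin (ℓ i) => c i (Fin.natAdd (m i) j))
        (fun j : Fin (m i) => c i (Fin.castAdd (ℓ i) j)),
      IsCompact {y : {k : Fin n // k ∈ I i} → ℝ |
        0 ≤ eval (fun k => if hk : k ∈ I i then y ⟨k, hk⟩ else 0) p})
    -- f_min is the optimal value of (P)
    (fmin : ℝ)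
    (hmin : IsLeast {y : ℝ | ∃ x : Fin n → ℝ,
        (∀ i, (∀ j : Fin (ℓ i), eval x (c i (Fin.natAdd (m i) j)) = 0) ∧
          (∀ j : Fin (m i), 0 ≤ eval x (c i (Fin.castAdd (ℓ i) j)))) ∧
        (∑ i, eval x (f i)) = y} fmin)
    -- (1): at least one minimizer of (P) is a KKT point
    (hkkt : ∃ (x : Fin n → ℝ) (lam : ∀ i, Fin (m i + ℓ i) → ℝ),
      (∑ i, eval x (f i)) = fmin ∧
      (∀ k : Fin n, (∑ i, eval x (pderiv k (f i))) =
          ∑ i, ∑ j, lam i j * eval x (pderiv k (c i j))) ∧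
      (∀ i, (∀ j : Fin (ℓ i), eval x (c i (Fin.natAdd (m i) j)) = 0) ∧
        (∀ j : Fin (m i), 0 ≤ lam i (Fin.castAdd (ℓ i) j)
          ∧ 0 ≤ eval x (c i (Fin.castAdd (ℓ i) j))
          ∧ lam i (Fin.castAdd (ℓ i) j) * eval x (c i (Fin.castAdd (ℓ i) j)) = 0))) :
    -- lim_{d → ∞} ϑ_d = f_min
    Filter.Tendsto (fun d : ℕ =>
        sSup {γ : ℝ | ∃ u : Fin s → MvPolynomial (BigVar n s) ℝ,
          (∀ i, u i ∈ IQdeg (hatI I i) (phiP I f c L i) (psiP I f c L i) (2 * d)) ∧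
          (∑ i, (rename Sum.inl (f i) : MvPolynomial (BigVar n s) ℝ)) - C γ = ∑ i, u i})
      Filter.atTop (nhds fmin) := by
  obtain ⟨x, lam, hval, hgrad, hx⟩ := hkkt
  obtain ⟨ν, hν⟩ := hrip.exists_reformulation_point hcover hf hc hLD hgrad
    (fun i => (hx i).1) (fun i => (hx i).2)
  have hupper : ∀ d γ, (∃ u : Fin s → MvPolynomial (BigVar n s) ℝ,
      (∀ i, u i ∈ IQdeg (hatI I i) (phiP I f c L i) (psiP I f c L i) (2 * d)) ∧
      (∑ i, (rename Sum.inl (f i) : MvPolynomial (BigVar n s) ℝ)) - C γ = ∑ i, u i) →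
      γ ≤ fmin := by
    rintro d γ ⟨u, hu, hsum⟩
    have e := congrArg (eval (Sum.elim x ν)) hsum
    simp only [map_sub, map_sum, eval_rename, Sum.elim_comp_inl, eval_C, hval] at e
    have : 0 ≤ ∑ i, eval (Sum.elim x ν) (u i) := Finset.sum_nonneg fun i _ =>
      eval_nonneg_of_mem_IQdeg (hu i) (hν i).1 (hν i).2
    linarith
  have hext : ∀ i (y : {k : Fin n // k ∈ I i} → ℝ),
      (fun k => if hk : k ∈ I i then y ⟨k, hk⟩ else 0) = zeroExtend (I i) y := by
    intro i y
    funext k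
    by_cases hk : k ∈ I i <;> simp [zeroExtend, hk]
  have harch' := harch
  simp only [hext] at harch'
  have hlower : ∀ γ < fmin, ∀ᶠ d : ℕ in Filter.atTop, ∃ γ' ≥ γ,
      ∃ u : Fin s → MvPolynomial (BigVar n s) ℝ,
        (∀ i, u i ∈ IQdeg (hatI I i) (phiP I f c L i) (psiP I f c L i) (2 * d)) ∧
        (∑ i, (rename Sum.inl (f i) : MvPolynomial (BigVar n s) ℝ)) - C γ' = ∑ i, u i := by
    intro γ hγ
    rcases Nat.eq_zero_or_pos s with rfl | hs
    · rw [Finset.univ_eq_empty, Finset.sum_empty] at hval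
      exact Filter.Eventually.of_forall fun d => ⟨0, by linarith, fun i => i.elim0,
        fun i => i.elim0, by simp⟩
    · have : NeZero s := ⟨hs.ne'⟩
      filter_upwards [hrip.eventually_exists_certificate (L := L) hf hc harch'
        (fun x hx => hγ.trans_le (hmin.2 ⟨x, hx, rfl⟩))] with d hd
      exact ⟨γ, le_rfl, hd⟩
  refine tendsto_order.2 ⟨fun a ha => ?_, fun a ha => ?_⟩
  · obtain ⟨γ, haγ, hγ⟩ := exists_between ha
    filter_upwards [hlower γ hγ] with d hd
    obtain ⟨γ', hγ', hd⟩ := hd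
    exact (haγ.trans_le hγ').trans_le (le_csSup ⟨fmin, hupper d⟩ hd)
  · filter_upwards [hlower (fmin - 1) (by linarith)] with d hd
    obtain ⟨γ', -, hd⟩ := hd
    exact (csSup_le ⟨γ', hd⟩ (hupper d)).trans_lt ha
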